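/- arXiv:2311.11877 — 3 statements merged into one kernel-verified Lean document; each statement's English description precedes it below -/
import Mathlib

section
/- Let d ≥ 1, q > 1 and 2 < p < ∞ satisfy 1/p + α/d = 1/q for some α > 0 (equivalently α = d(1/q − 1/p) > 0). There exists a constant C > 0 such that for every Schwartz function f : ℝ^d → ℂ, if g := 𝓕^{-1}(ξ ↦ |ξ|^α 𝓕f(ξ)) = Λ^α f, then ‖f‖_{L^p(ℝ^d)} ≤ C ‖g‖_{L^q(ℝ^d)}. -/
open MeasureTheory Real Set
open scoped FourierTransform ENNReal

noncomputable section

/-- Euclidean space ℝ^d. -/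
abbrev Rd (d : ℕ) := EuclideanSpace ℝ (Fin d)

/-- Fourier transform of a real-valued function on ℝ^d. -/
def FT {d : ℕ} (f : Rd d → ℝ) : Rd d → ℂ := 𝓕 (fun x => (f x : ℂ))

/-- Squared inhomogeneous Sobolev norm ‖f‖²_{H^r}. -/
def HSq {d : ℕ} (r : ℝ) (f : Rd d → ℝ) : ℝ≥0∞ :=
  ∫⁻ ξ : Rd d, ENNReal.ofReal ((1 + ‖ξ‖ ^ 2) ^ r * ‖FT f ξ‖ ^ 2)

/-- Inhomogeneous Sobolev norm ‖f‖_{H^r}. -/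
def Hn {d : ℕ} (r : ℝ) (f : Rd d → ℝ) : ℝ≥0∞ := (HSq r f) ^ (1/2 : ℝ)

/-- Squared homogeneous Sobolev norm ‖f‖²_{Ḣ^r}. -/
def HdotSq {d : ℕ} (r : ℝ) (f : Rd d → ℝ) : ℝ≥0∞ :=
  ∫⁻ ξ : Rd d, ENNReal.ofReal (‖ξ‖ ^ (2 * r) * ‖FT f ξ‖ ^ 2)

/-- Homogeneous Sobolev norm ‖f‖_{Ḣ^r} = ‖Λ^r f‖. -/
def Hdot {d : ℕ} (r : ℝ) (f : Rd d → ℝ) : ℝ≥0∞ := (HdotSq r f) ^ (1/2 : ℝ)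

/-- The fractional operator Λ^β on (complex-valued) Schwartz-class data. -/
def LamC {d : ℕ} (β : ℝ) (f : Rd d → ℂ) : Rd d → ℂ :=
  𝓕⁻ (fun ξ : Rd d => (‖ξ‖ ^ β : ℝ) • 𝓕 f ξ)

open Filter Topology

/-! ### Gamma-type integrals over the half-line -/

lemma integrableOn_rpow_mul_exp_neg_mul_Ioi {a c : ℝ} (ha : 0 < a) (hc : 0 < c) :
    IntegrableOn (fun t : ℝ => t ^ (a - 1) * rexp (-(c * t))) (Ioi 0) := by
  simpa using integrableOn_rpow_mul_exp_neg_mul_rpow (p := 1) (s := a - 1) (b := c)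
    (by linarith) one_pos hc

lemma lintegral_rpow_mul_exp_neg_div_Ioi {a c : ℝ} (ha : 0 < a) (hc : 0 < c) :
    ∫⁻ t in Ioi (0 : ℝ), ENNReal.ofReal (t ^ (-a - 1) * rexp (-(c / t))) =
      ENNReal.ofReal ((1 / c) ^ a * Gamma a) := by
  have key : ∀ t ∈ Ioi (0 : ℝ), t ^ (-a - 1) * rexp (-(c / t)) =
      (|(-1 : ℝ)| * t ^ ((-1 : ℝ) - 1)) •
        ((fun t : ℝ => t ^ (a - 1) * rexp (-(c * t))) (t ^ (-1 : ℝ))) := by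
    intro t ht
    have ht : 0 < t := ht
    simp only [abs_neg, abs_one, one_mul, smul_eq_mul]
    rw [← rpow_mul ht.le, ← mul_assoc, ← rpow_add ht, rpow_neg_one, div_eq_mul_inv]
    ring_nf
  have hint := (integrableOn_Ioi_comp_rpow_iff
    (fun t : ℝ => t ^ (a - 1) * rexp (-(c * t))) (p := -1) (by norm_num)).2
    (integrableOn_rpow_mul_exp_neg_mul_Ioi ha hc)
  rw [← integral_rpow_mul_exp_neg_mul_Ioi ha hc,
    ← integral_comp_rpow_Ioi _ (show (-1 : ℝ) ≠ 0 by norm_num),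
    ofReal_integral_eq_lintegral_ofReal hint]
  · exact setLIntegral_congr_fun measurableSet_Ioi fun t ht => by rw [key t ht]
  · refine (ae_restrict_iff' measurableSet_Ioi).2 (ae_of_all _ fun t ht => ?_)
    have ht : 0 < t := ht
    simp only [Pi.zero_apply]
    rw [← key t ht]
    positivity

lemma lintegral_Ioi_rpow {a c : ℝ} (ha : 0 < a) (hc : 0 < c) :
    ∫⁻ t in Ioi c, ENNReal.ofReal (t ^ (-a - 1)) = ENNReal.ofReal (c ^ (-a) / a) := by
  rw [← ofReal_integral_eq_lintegral_ofReal (integrableOn_Ioi_rpow_of_lt (by linarith) hc)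
    ((ae_restrict_iff' measurableSet_Ioi).2 (ae_of_all _ fun t ht =>
      rpow_nonneg (hc.trans ht).le _)), integral_Ioi_rpow_of_lt (by linarith) hc]
  congr 1
  rw [sub_add_cancel, neg_div_neg_eq]

/-! ### Representation of a Schwartz function by the Riesz potential of `LamC α f` -/

lemma integrable_norm_rpow_smul_fourier {d : ℕ} {α : ℝ} (hα : 0 < α) (f : SchwartzMap (Rd d) ℂ) :
    Integrable (fun ξ : Rd d => (‖ξ‖ ^ α : ℝ) • 𝓕 (⇑f) ξ) := by
  rw [← SchwartzMap.fourier_coe]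
  obtain ⟨k, hk⟩ := exists_nat_ge α
  refine ((𝓕 f).integrable.norm.add ((𝓕 f).integrable_pow_mul volume k)).mono' ?_
    (ae_of_all _ fun ξ => ?_)
  · have : Continuous fun ξ : Rd d => (‖ξ‖ ^ α : ℝ) :=
      continuous_norm.rpow_const fun _ => Or.inr hα.le
    exact (this.smul (𝓕 f).continuous).aestronglyMeasurable
  · have h : ‖ξ‖ ^ α ≤ 1 + ‖ξ‖ ^ k := by
      rcases le_total ‖ξ‖ 1 with h | h
      · have := rpow_le_one (norm_nonneg ξ) h hα.le
        have : 0 ≤ ‖ξ‖ ^ k := by positivity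
        linarith
      · have := rpow_le_rpow_of_exponent_le h hk
        rw [rpow_natCast] at this
        linarith
    rw [norm_smul, Real.norm_of_nonneg (by positivity)]
    calc _ ≤ (1 + ‖ξ‖ ^ k) * ‖𝓕 f ξ‖ := by gcongr
      _ = _ := by simp; ring

lemma integral_gaussian_smul_fourierInv {d : ℕ} {H : Rd d → ℂ} (hH : Integrable H) {t : ℝ}
    (ht : 0 < t) (x : Rd d) :
    ∫ y, ((t ^ (-(d / 2 : ℝ)) * rexp (-(π * ‖x - y‖ ^ 2 / t)) : ℝ) : ℂ) * 𝓕⁻ H y =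
      ∫ ξ, (rexp (-(π * ‖ξ‖ ^ 2 * t)) : ℂ) *
        (Complex.exp (2 * π * Complex.I * inner ℝ x ξ) * H ξ) := by
  set b : ℂ := ((π * t : ℝ) : ℂ) with hb_def
  have hb : 0 < b.re := by simp only [hb_def, Complex.ofReal_re]; positivity
  set G : Rd d → ℂ := fun v =>
    Complex.exp (-b * ‖v‖ ^ 2 + 2 * π * Complex.I * inner ℝ x v) with hG
  have hGi : Integrable G := by
    simpa [hG] using GaussianFourier.integrable_cexp_neg_mul_sq_norm_add hb (2 * π * Complex.I) x
  have hGc : Continuous G := by fun_prop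
  have hFG : 𝓕 G = fun y => ((t ^ (-(d / 2 : ℝ)) * rexp (-(π * ‖x - y‖ ^ 2 / t)) : ℝ) : ℂ) := by
    ext y
    rw [hG, fourier_gaussian_innerProductSpace' hb]
    have hπ : (π : ℂ) ≠ 0 := by exact_mod_cast pi_ne_zero
    have htc : (t : ℂ) ≠ 0 := by exact_mod_cast ht.ne'
    push_cast
    congr 1
    · have : (π : ℂ) / b = ((t⁻¹ : ℝ) : ℂ) := by
        rw [hb_def]; push_cast; field_simp
      rw [this, finrank_euclideanSpace_fin, rpow_neg ht.le, ← inv_rpow ht.le,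
        Complex.ofReal_cpow (by positivity)]
      push_cast
      rfl
    · congr 1
      rw [hb_def]; push_cast; field_simp
  have hFGi : Integrable (𝓕 G) := by
    rw [hFG]
    apply Integrable.ofReal
    apply Integrable.const_mul
    have := GaussianFourier.integrable_cexp_neg_mul_sq_norm_add (V := Rd d)
      (b := ((π / t : ℝ) : ℂ)) (by simp only [Complex.ofReal_re]; positivity) 0 0
    have := (this.comp_sub_left x).re
    refine this.congr (ae_of_all _ fun y => ?_)
    simp only [zero_mul, add_zero]
    rw [← Complex.ofReal_neg, ← Complex.ofReal_pow, ← Complex.ofReal_mul, ← Complex.ofReal_exp]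
    simp only [RCLike.re_to_complex, Complex.ofReal_re]
    congr 1
    ring
  have hinv : 𝓕⁻ (𝓕 G) = G := hGc.fourierInv_fourier_eq hGi hFGi
  have hswap := VectorFourier.integral_fourierIntegral_smul_eq_flip (L := -innerₗ (Rd d))
    (μ := volume) (ν := volume) continuous_fourierChar
    (by exact (continuous_inner (𝕜 := ℝ) (E := Rd d)).neg) hFGi hH
  have h1 : ∀ F : Rd d → ℂ, VectorFourier.fourierIntegral 𝐞 volume (-innerₗ (Rd d)) F = 𝓕⁻ F := by
    intro F; rfl
  have h2 : (-innerₗ (Rd d)).flip = -innerₗ (Rd d) := by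
    ext; simp [real_inner_comm]
  rw [h2, h1, h1, hinv] at hswap
  rw [hFG] at hswap
  simp only [smul_eq_mul] at hswap
  rw [← hswap]
  refine integral_congr_ae (ae_of_all _ fun ξ => ?_)
  simp only [hG, hb_def]
  rw [Complex.exp_add, mul_assoc]
  congr 2
  push_cast
  ring_nf

lemma mul_eq_integral_heat {d : ℕ} (hd : 1 ≤ d) {α : ℝ} (hα : 0 < α) (f : SchwartzMap (Rd d) ℂ)
    (x : Rd d) :
    (((1 / π) ^ (α / 2) * Gamma (α / 2) : ℝ) : ℂ) * f x =
      ∫ t in Ioi (0 : ℝ), ∫ ξ : Rd d, ((t ^ (α / 2 - 1) * rexp (-(π * ‖ξ‖ ^ 2 * t)) : ℝ) : ℂ) *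
        (Complex.exp (2 * π * Complex.I * inner ℝ x ξ) * ((‖ξ‖ ^ α : ℝ) • 𝓕 (⇑f) ξ)) := by
  have : NeZero d := ⟨by omega⟩
  have hα2 : 0 < α / 2 := by positivity
  have hexp : ∀ ξ : Rd d, ‖Complex.exp (2 * π * Complex.I * inner ℝ x ξ)‖ = 1 := by
    intro ξ
    rw [show (2 * π * Complex.I * inner ℝ x ξ : ℂ) =
      ((2 * π * inner ℝ x ξ : ℝ) : ℂ) * Complex.I by push_cast; ring,
      Complex.norm_exp_ofReal_mul_I]
  have hne : ∀ᵐ ξ : Rd d, ξ ≠ 0 := by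
    simp [ae_iff, measure_singleton]
  have hpow : ∀ ξ : Rd d, ξ ≠ 0 → (1 / (π * ‖ξ‖ ^ 2)) ^ (α / 2) * Gamma (α / 2) * ‖ξ‖ ^ α =
      (1 / π) ^ (α / 2) * Gamma (α / 2) := by
    intro ξ hξ
    have hξ : 0 < ‖ξ‖ := norm_pos_iff.2 hξ
    rw [one_div, one_div, mul_inv, mul_rpow (by positivity) (by positivity),
      inv_rpow (by positivity) (α / 2), inv_rpow (by positivity) (α / 2), ← rpow_natCast ‖ξ‖,
      ← rpow_mul hξ.le]
    have : ((2 : ℕ) : ℝ) * (α / 2) = α := by push_cast; ring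
    rw [this]
    field_simp
  have hinner : ∀ ξ : Rd d, ξ ≠ 0 → ∫ t in Ioi (0 : ℝ), t ^ (α / 2 - 1) *
      rexp (-(π * ‖ξ‖ ^ 2 * t)) = (1 / (π * ‖ξ‖ ^ 2)) ^ (α / 2) * Gamma (α / 2) :=
    fun ξ hξ => integral_rpow_mul_exp_neg_mul_Ioi hα2
      (by have := norm_pos_iff.2 hξ; positivity)
  have hmeas : Continuous (𝓕 (⇑f)) := by
    rw [← SchwartzMap.fourier_coe]; exact (𝓕 f).continuous
  have hFi : Integrable (𝓕 (⇑f)) := by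
    rw [← SchwartzMap.fourier_coe]; exact (𝓕 f).integrable
  rw [integral_integral_swap]
  · have hinv : f x = ∫ ξ, Complex.exp (2 * π * Complex.I * inner ℝ x ξ) * 𝓕 (⇑f) ξ := by
      rw [← congrFun (f.continuous.fourierInv_fourier_eq f.integrable hFi) x, fourierInv_eq']
      refine integral_congr_ae (ae_of_all _ fun ξ => ?_)
      simp only [smul_eq_mul]
      congr 2
      rw [real_inner_comm]
      push_cast
      ring
    rw [hinv, ← integral_const_mul]
    refine integral_congr_ae (hne.mono fun ξ hξ => ?_)
    simp only
    rw [integral_mul_const, integral_complex_ofReal, hinner ξ hξ, ← hpow ξ hξ, Complex.real_smul]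
    push_cast
    ring
  · rw [integrable_prod_iff']
    · have hnorm : ∀ ξ : Rd d, ∀ t ∈ Ioi (0 : ℝ),
          ‖((t ^ (α / 2 - 1) * rexp (-(π * ‖ξ‖ ^ 2 * t)) : ℝ) : ℂ) *
            (Complex.exp (2 * π * Complex.I * inner ℝ x ξ) * ((‖ξ‖ ^ α : ℝ) • 𝓕 (⇑f) ξ))‖ =
          t ^ (α / 2 - 1) * rexp (-(π * ‖ξ‖ ^ 2 * t)) * (‖ξ‖ ^ α * ‖𝓕 (⇑f) ξ‖) := by
        intro ξ t ht
        have ht : 0 < t := ht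
        rw [norm_mul, norm_mul, hexp, norm_smul, Complex.norm_real,
          Real.norm_of_nonneg (by positivity), Real.norm_of_nonneg (by positivity), one_mul]
      refine ⟨hne.mono fun ξ hξ => ?_, ?_⟩
      · simp only [Function.uncurry]
        apply Integrable.mul_const
        apply Integrable.ofReal
        exact integrableOn_rpow_mul_exp_neg_mul_Ioi hα2
          (by have := norm_pos_iff.2 hξ; positivity)
      · refine (hFi.norm.const_mul ((1 / π) ^ (α / 2) * Gamma (α / 2))).congr
          (hne.mono fun ξ hξ => ?_)
        simp only [Function.uncurry]
        rw [setIntegral_congr_fun measurableSet_Ioi (hnorm ξ), integral_mul_const, hinner ξ hξ,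
          ← hpow ξ hξ]
        ring
    · have h1 : Measurable fun p : ℝ × Rd d =>
          ((p.1 ^ (α / 2 - 1) * rexp (-(π * ‖p.2‖ ^ 2 * p.1)) : ℝ) : ℂ) := by fun_prop
      have h2 : Measurable fun p : ℝ × Rd d =>
          (Complex.exp (2 * π * Complex.I * inner ℝ x p.2) * ((‖p.2‖ ^ α : ℝ) • 𝓕 (⇑f) p.2)) := by
        have h3 : Measurable fun p : ℝ × Rd d => 𝓕 (⇑f) p.2 := hmeas.measurable.comp measurable_snd
        have h4 : Measurable fun p : ℝ × Rd d => (‖p.2‖ ^ α : ℝ) := by fun_prop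
        have h5 : Measurable fun p : ℝ × Rd d =>
            Complex.exp (2 * π * Complex.I * inner ℝ x p.2) := by fun_prop
        exact h5.mul (h4.smul h3)
      exact (h1.mul h2).aestronglyMeasurable

lemma continuous_LamC {d : ℕ} {α : ℝ} (hα : 0 < α) (f : SchwartzMap (Rd d) ℂ) :
    Continuous (LamC α ⇑f) :=
  VectorFourier.fourierIntegral_continuous (L := -innerₗ (Rd d)) continuous_fourierChar
    (by exact (continuous_inner (𝕜 := ℝ) (E := Rd d)).neg) (integrable_norm_rpow_smul_fourier hα f)

lemma exists_norm_LamC_le {d : ℕ} (α : ℝ) (f : SchwartzMap (Rd d) ℂ) :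
    ∃ B, ∀ x, ‖LamC α (⇑f) x‖ ≤ B :=
  ⟨_, VectorFourier.norm_fourierIntegral_le_integral_norm 𝐞 volume (-innerₗ (Rd d)) _⟩

/-- A Schwartz function is dominated by the Riesz potential of `|LamC α f|`. -/
lemma exists_enorm_le_lintegral_riesz {d : ℕ} (hd : 1 ≤ d) {α : ℝ} (hα : 0 < α) (hαd : α < d) :
    ∃ C : ℝ, ∀ (f : SchwartzMap (Rd d) ℂ) (x : Rd d),
      ‖f x‖ₑ ≤ ENNReal.ofReal C *
        ∫⁻ y, ENNReal.ofReal (‖x - y‖ ^ (-(d - α))) * ‖LamC α (⇑f) y‖ₑ := by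
  have : NeZero d := ⟨by omega⟩
  set a : ℝ := (d - α) / 2 with ha_def
  have ha : 0 < a := by rw [ha_def]; linarith
  set K : ℝ := (1 / π) ^ (α / 2) * Gamma (α / 2) with hK_def
  have hK : 0 < K := mul_pos (by positivity) (Gamma_pos_of_pos (by positivity))
  set L : ℝ := (1 / π) ^ a * Gamma a with hL_def
  have hL : 0 < L := mul_pos (by positivity) (Gamma_pos_of_pos ha)
  refine ⟨L / K, fun f x => ?_⟩
  have hg := continuous_LamC hα f
  have hbound : ENNReal.ofReal K * ‖f x‖ₑ ≤ ENNReal.ofReal L *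
      ∫⁻ y, ENNReal.ofReal (‖x - y‖ ^ (-(d - α))) * ‖LamC α (⇑f) y‖ₑ := by
    calc ENNReal.ofReal K * ‖f x‖ₑ = ‖(K : ℂ) * f x‖ₑ := by
          rw [enorm_mul, ← ofReal_norm (K : ℂ), Complex.norm_real,
            Real.norm_of_nonneg hK.le]
      _ ≤ ∫⁻ t in Ioi (0 : ℝ), ‖∫ ξ : Rd d,
            ((t ^ (α / 2 - 1) * rexp (-(π * ‖ξ‖ ^ 2 * t)) : ℝ) : ℂ) *
            (Complex.exp (2 * π * Complex.I * inner ℝ x ξ) * ((‖ξ‖ ^ α : ℝ) • 𝓕 (⇑f) ξ))‖ₑ := by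
          rw [hK_def, mul_eq_integral_heat hd hα f x]
          exact enorm_integral_le_lintegral_enorm _
      _ ≤ ∫⁻ t in Ioi (0 : ℝ), ∫⁻ y, ENNReal.ofReal (t ^ (-a - 1) *
            rexp (-(π * ‖x - y‖ ^ 2 / t))) * ‖LamC α (⇑f) y‖ₑ := by
          refine setLIntegral_mono' measurableSet_Ioi fun t ht => ?_
          have ht : 0 < t := ht
          have := integral_gaussian_smul_fourierInv (integrable_norm_rpow_smul_fourier hα f) ht x
          simp only [Complex.ofReal_mul (_ ^ (α / 2 - 1)), mul_assoc ((_ ^ (α / 2 - 1) : ℝ) : ℂ)]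
          rw [integral_const_mul, ← this, ← integral_const_mul]
          refine (enorm_integral_le_lintegral_enorm _).trans (lintegral_mono fun y => ?_)
          rw [← mul_assoc, ← Complex.ofReal_mul, enorm_mul, ← ofReal_norm (Complex.ofReal _),
            Complex.norm_real, Real.norm_of_nonneg (by positivity), ← mul_assoc, ← rpow_add ht]
          have : α / 2 - 1 + -(d / 2 : ℝ) = -a - 1 := by rw [ha_def]; ring
          rw [this]
          rfl
      _ = ∫⁻ y, ∫⁻ t in Ioi (0 : ℝ), ENNReal.ofReal (t ^ (-a - 1) *
            rexp (-(π * ‖x - y‖ ^ 2 / t))) * ‖LamC α (⇑f) y‖ₑ := by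
          apply lintegral_lintegral_swap
          have h1 : Measurable fun p : ℝ × Rd d =>
            ENNReal.ofReal (p.1 ^ (-a - 1) * rexp (-(π * ‖x - p.2‖ ^ 2 / p.1))) := by fun_prop
          have h2 : Measurable fun p : ℝ × Rd d => ‖LamC α (⇑f) p.2‖ₑ :=
            (hg.measurable.comp measurable_snd).enorm
          exact (h1.mul h2).aemeasurable
      _ = ∫⁻ y, ENNReal.ofReal L *
            (ENNReal.ofReal (‖x - y‖ ^ (-(d - α))) * ‖LamC α (⇑f) y‖ₑ) := by
          have hne : ∀ᵐ y : Rd d, y ≠ x := by simp [ae_iff, measure_singleton]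
          refine lintegral_congr_ae (hne.mono fun y hy => ?_)
          have hxy : 0 < ‖x - y‖ := norm_pos_iff.2 (sub_ne_zero.2 hy.symm)
          simp only
          rw [lintegral_mul_const _ (by fun_prop),
            lintegral_rpow_mul_exp_neg_div_Ioi ha (by positivity), ← mul_assoc,
            ← ENNReal.ofReal_mul hL.le, hL_def]
          congr 2
          rw [one_div, one_div, mul_inv, mul_rpow (by positivity) (by positivity),
            inv_rpow (by positivity) a, inv_rpow (by positivity) a, ← rpow_natCast ‖x - y‖,
            ← rpow_mul hxy.le, ← rpow_neg hxy.le]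
          have : -(((2 : ℕ) : ℝ) * a) = -(d - α) := by rw [ha_def]; push_cast; ring
          rw [this]
          ring
      _ = _ := lintegral_const_mul _ (by
          have := hg.measurable.enorm
          exact (by fun_prop : Measurable fun y : Rd d =>
            ENNReal.ofReal (‖x - y‖ ^ (-(d - α)))).mul this)
  have hK' : ENNReal.ofReal K ≠ 0 := by simpa using hK
  rw [ENNReal.ofReal_div_of_pos hK, div_eq_mul_inv, mul_right_comm, ← div_eq_mul_inv,
    ENNReal.le_div_iff_mul_le (Or.inl hK') (Or.inl ENNReal.ofReal_ne_top), mul_comm]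
  exact hbound

/-! ### The Hardy–Littlewood maximal function -/

/-- The centred Hardy–Littlewood maximal function over balls of dyadic radius, normalised by
`r ^ d` instead of the volume of the ball. -/
def dyadicMaximal {d : ℕ} (h : Rd d → ℝ≥0∞) (x : Rd d) : ℝ≥0∞ :=
  ⨆ n : ℤ, (∫⁻ y in Metric.ball x ((2 : ℝ) ^ n), h y) / ENNReal.ofReal (((2 : ℝ) ^ n) ^ d)

lemma measurable_lintegral_ball {d : ℕ} {h : Rd d → ℝ≥0∞} (hh : Measurable h) :
    Measurable fun p : Rd d × ℝ => ∫⁻ y in Metric.ball p.1 p.2, h y := by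
  have : (fun p : Rd d × ℝ => ∫⁻ y in Metric.ball p.1 p.2, h y) = fun p =>
      ∫⁻ y, {q : (Rd d × ℝ) × Rd d | dist q.2 q.1.1 < q.1.2}.indicator (fun q => h q.2) (p, y) := by
    ext p
    rw [← lintegral_indicator Metric.isOpen_ball.measurableSet]
    rfl
  rw [this]
  apply Measurable.lintegral_prod_right'
  refine (hh.comp measurable_snd).indicator (measurableSet_lt ?_ ?_) <;> fun_prop

lemma measurable_dyadicMaximal {d : ℕ} {h : Rd d → ℝ≥0∞} (hh : Measurable h) :
    Measurable (dyadicMaximal h) := by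
  have hball (r : ℝ) : Measurable fun x : Rd d => ∫⁻ y in Metric.ball x r, h y := by
    have := (measurable_lintegral_ball hh).comp
      (measurable_prodMk_right (α := Rd d) (β := ℝ) (y := r))
    simpa only [Function.comp_def] using this
  exact Measurable.iSup fun n => (hball _).div_const _

lemma lintegral_ball_le_dyadicMaximal {d : ℕ} (h : Rd d → ℝ≥0∞) (x : Rd d) {r : ℝ} (hr : 0 < r) :
    ∫⁻ y in Metric.ball x r, h y ≤ ENNReal.ofReal ((2 * r) ^ d) * dyadicMaximal h x := by
  obtain ⟨n, hn1, hn2⟩ := exists_mem_Ico_zpow hr (one_lt_two)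
  have hpos : (0 : ℝ) < 2 ^ (n + 1) := by positivity
  have h2 : (2 : ℝ) ^ (n + 1) ≤ 2 * r := by
    rw [zpow_add_one₀ two_ne_zero]; linarith
  calc ∫⁻ y in Metric.ball x r, h y ≤ ∫⁻ y in Metric.ball x (2 ^ (n + 1)), h y :=
        lintegral_mono_set (Metric.ball_subset_ball hn2.le)
    _ = ENNReal.ofReal (((2 : ℝ) ^ (n + 1)) ^ d) *
          ((∫⁻ y in Metric.ball x (2 ^ (n + 1)), h y) /
            ENNReal.ofReal (((2 : ℝ) ^ (n + 1)) ^ d)) := by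
        rw [ENNReal.mul_div_cancel (by simp; positivity) ENNReal.ofReal_ne_top]
    _ ≤ _ := by
        gcongr
        exact le_iSup (fun n : ℤ => (∫⁻ y in Metric.ball x ((2 : ℝ) ^ n), h y) /
          ENNReal.ofReal (((2 : ℝ) ^ n) ^ d)) (n + 1)

lemma volume_ball_eq {d : ℕ} (hd : 1 ≤ d) (x : Rd d) {r : ℝ} (hr : 0 ≤ r) :
    volume (Metric.ball x r) =
      ENNReal.ofReal (r ^ d) * volume (Metric.ball (0 : Rd d) 1) := by
  have : NeZero d := ⟨by omega⟩
  rw [Measure.addHaar_ball _ _ hr, finrank_euclideanSpace_fin]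

/-- The weak type `(1, 1)` bound for the maximal function. -/
lemma volume_lt_dyadicMaximal_le {d : ℕ} (hd : 1 ≤ d) (h : Rd d → ℝ≥0∞) {l : ℝ} (hl : 0 < l) :
    volume {x | ENNReal.ofReal l < dyadicMaximal h x} ≤
      ENNReal.ofReal (5 ^ d) * volume (Metric.ball (0 : Rd d) 1) *
        ((∫⁻ y, h y) / ENNReal.ofReal l) := by
  have : NeZero d := ⟨by omega⟩
  set v := volume (Metric.ball (0 : Rd d) 1)
  have hv0 : v ≠ 0 := (Metric.measure_ball_pos _ _ one_pos).ne'
  have hl0 : ENNReal.ofReal l ≠ 0 := by simpa using hl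
  rcases eq_or_ne (∫⁻ y, h y) ∞ with htop | htop
  · rw [htop, ENNReal.top_div_of_ne_top ENNReal.ofReal_ne_top, ENNReal.mul_top]
    · exact le_top
    · simp [hv0]
  set t : Set (Rd d × ℤ) := {p | ENNReal.ofReal l * ENNReal.ofReal (((2 : ℝ) ^ p.2) ^ d) <
    ∫⁻ y in Metric.ball p.1 ((2 : ℝ) ^ p.2), h y} with ht_def
  set r : Rd d × ℤ → ℝ := fun p => (2 : ℝ) ^ p.2 with hr_def
  have hrpos : ∀ p, 0 < r p := fun p => by simp only [hr_def]; positivity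
  obtain ⟨R, hR⟩ : ∃ R : ℝ, ∀ p ∈ t, r p ≤ R := by
    refine ⟨max 1 ((∫⁻ y, h y).toReal / l), fun p hp => ?_⟩
    rcases le_total (r p) 1 with h1 | h1
    · exact h1.trans (le_max_left _ _)
    · refine le_trans ?_ (le_max_right _ _)
      rw [le_div_iff₀ hl, ← ENNReal.ofReal_le_iff_le_toReal htop]
      calc ENNReal.ofReal (r p * l) ≤ ENNReal.ofReal (l * r p ^ d) := by
            rw [mul_comm]
            gcongr
            exact le_self_pow₀ h1 (by omega)
        _ = ENNReal.ofReal l * ENNReal.ofReal (r p ^ d) := ENNReal.ofReal_mul hl.le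
        _ ≤ ∫⁻ y in Metric.ball p.1 (r p), h y := hp.le
        _ ≤ _ := setLIntegral_le_lintegral _ _
  obtain ⟨u, hut, hdisj, hcov⟩ := Vitali.exists_disjoint_subfamily_covering_enlargement_closedBall
    t Prod.fst r R hR 4 (by norm_num)
  have hcount : u.Countable := hdisj.countable_of_nonempty_interior fun p _ =>
    ⟨p.1, Metric.ball_subset_interior_closedBall (Metric.mem_ball_self (hrpos p))⟩
  have hsub : {x | ENNReal.ofReal l < dyadicMaximal h x} ⊆
      ⋃ p ∈ u, Metric.ball p.1 (5 * r p) := by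
    intro x hx
    simp only [mem_ofPred_eq, dyadicMaximal, lt_iSup_iff] at hx
    obtain ⟨n, hn⟩ := hx
    have hmem : (x, n) ∈ t := by
      rw [ENNReal.lt_div_iff_mul_lt (by simp) (by simp)] at hn
      exact hn
    obtain ⟨b, hb, hsubb⟩ := hcov _ hmem
    refine mem_biUnion hb ?_
    exact Metric.closedBall_subset_ball (by linarith [hrpos b])
      (hsubb (Metric.mem_closedBall_self (hrpos _).le))
  calc volume {x | ENNReal.ofReal l < dyadicMaximal h x}
      ≤ volume (⋃ p ∈ u, Metric.ball p.1 (5 * r p)) := measure_mono hsub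
    _ ≤ ∑' p : u, volume (Metric.ball p.1.1 (5 * r p)) := measure_biUnion_le _ hcount _
    _ ≤ ∑' p : u, ENNReal.ofReal (5 ^ d) * v *
          ((∫⁻ y in Metric.closedBall p.1.1 (r p), h y) / ENNReal.ofReal l) := by
        refine ENNReal.tsum_le_tsum fun p => ?_
        rw [volume_ball_eq hd _ (by linarith [hrpos p.1]), mul_pow,
          ENNReal.ofReal_mul (by positivity), mul_assoc, mul_assoc, mul_comm v]
        gcongr
        rw [ENNReal.le_div_iff_mul_le (Or.inl hl0) (Or.inl ENNReal.ofReal_ne_top), mul_comm]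
        exact (hut p.2).le.trans (lintegral_mono_set Metric.ball_subset_closedBall)
    _ = ENNReal.ofReal (5 ^ d) * v *
          ((∫⁻ y in ⋃ p ∈ u, Metric.closedBall p.1 (r p), h y) / ENNReal.ofReal l) := by
        rw [lintegral_biUnion hcount (fun p _ => Metric.isClosed_closedBall.measurableSet) hdisj,
          ENNReal.tsum_mul_left]
        simp only [div_eq_mul_inv, ENNReal.tsum_mul_right]
    _ ≤ _ := by
        gcongr
        exact Measure.restrict_le_self

lemma dyadicMaximal_le_of_le {d : ℕ} (hd : 1 ≤ d) {h : Rd d → ℝ≥0∞} {B : ℝ≥0∞}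
    (hB : ∀ y, h y ≤ B) (x : Rd d) :
    dyadicMaximal h x ≤ B * volume (Metric.ball (0 : Rd d) 1) := by
  refine iSup_le fun n => ENNReal.div_le_of_le_mul ?_
  calc _ ≤ ∫⁻ _ in Metric.ball x ((2 : ℝ) ^ n), B := lintegral_mono hB
    _ = _ := by
      rw [setLIntegral_const, volume_ball_eq hd _ (by positivity)]
      ring

lemma dyadicMaximal_add_le {d : ℕ} {h₁ h₂ : Rd d → ℝ≥0∞} (hh : Measurable h₁) (x : Rd d) :
    dyadicMaximal (h₁ + h₂) x ≤ dyadicMaximal h₁ x + dyadicMaximal h₂ x := by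
  refine iSup_le fun n => ?_
  simp only [Pi.add_apply]
  rw [lintegral_add_left hh, ENNReal.add_div]
  exact add_le_add (le_iSup (fun n : ℤ => (∫⁻ y in Metric.ball x ((2 : ℝ) ^ n), h₁ y) /
      ENNReal.ofReal (((2 : ℝ) ^ n) ^ d)) n)
    (le_iSup (fun n : ℤ => (∫⁻ y in Metric.ball x ((2 : ℝ) ^ n), h₂ y) /
      ENNReal.ofReal (((2 : ℝ) ^ n) ^ d)) n)

lemma lintegral_Ioc_rpow {a c : ℝ} (ha : 0 < a) (hc : 0 ≤ c) :
    ∫⁻ t in Ioc 0 c, ENNReal.ofReal (t ^ (a - 1)) = ENNReal.ofReal (c ^ a / a) := by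
  have hint := (intervalIntegral.intervalIntegrable_rpow' (a := 0) (b := c)
    (show -1 < a - 1 by linarith))
  rw [intervalIntegrable_iff_integrableOn_Ioc_of_le hc] at hint
  rw [← ofReal_integral_eq_lintegral_ofReal hint
    ((ae_restrict_iff' measurableSet_Ioc).2 (ae_of_all _ fun t ht => rpow_nonneg ht.1.le _)),
    ← intervalIntegral.integral_of_le hc, integral_rpow (Or.inl (by linarith))]
  congr 1
  rw [sub_add_cancel, zero_rpow ha.ne', sub_zero]

lemma setOf_lt_dyadicMaximal_subset {d : ℕ} (hd : 1 ≤ d) {H : Rd d → ℝ} (hH : Measurable H)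
    {l : ℝ} (hl : 0 < l) :
    {x | ENNReal.ofReal l < dyadicMaximal (fun y => ENNReal.ofReal (H y)) x} ⊆
      {x | ENNReal.ofReal (l / 2) < dyadicMaximal
        ({y | l < 2 * (volume (Metric.ball (0 : Rd d) 1)).toReal * H y}.indicator
          fun y => ENNReal.ofReal (H y)) x} := by
  have : NeZero d := ⟨by omega⟩
  set v := volume (Metric.ball (0 : Rd d) 1) with hv
  have hv_top : v ≠ ∞ := measure_ball_lt_top.ne
  have hw : 0 < v.toReal :=
    ENNReal.toReal_pos (Metric.measure_ball_pos _ _ one_pos).ne' hv_top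
  set S : Set (Rd d) := {y | l < 2 * v.toReal * H y} with hS
  have hSm : MeasurableSet S := measurableSet_lt measurable_const (hH.const_mul _)
  set h : Rd d → ℝ≥0∞ := fun y => ENNReal.ofReal (H y) with hh
  intro x hx
  simp only [mem_ofPred_eq] at hx ⊢
  by_contra! hcon
  have hsmall : dyadicMaximal (Sᶜ.indicator h) x ≤ ENNReal.ofReal (l / 2) := by
    calc _ ≤ ENNReal.ofReal (l / (2 * v.toReal)) * v := by
          refine dyadicMaximal_le_of_le hd (fun y => ?_) x
          by_cases hy : y ∈ S
          · simp [hy]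
          · rw [indicator_of_mem (show y ∈ Sᶜ from hy)]
            refine ENNReal.ofReal_le_ofReal ?_
            rw [le_div_iff₀ (by positivity), mul_comm]
            simpa [hS] using hy
      _ = _ := by
          nth_rw 2 [← ENNReal.ofReal_toReal hv_top]
          rw [← ENNReal.ofReal_mul (by positivity)]
          congr 1
          field_simp
  have hsum : h = S.indicator h + Sᶜ.indicator h := (indicator_self_add_compl S h).symm
  have hm : Measurable (S.indicator h) := hH.ennreal_ofReal.indicator hSm
  have := (congrFun (congrArg dyadicMaximal hsum) x).trans_le
    ((dyadicMaximal_add_le hm x).trans (add_le_add hcon hsmall))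
  rw [← ENNReal.ofReal_add (by positivity) (by positivity), add_halves] at this
  exact absurd hx (not_lt.2 this)

/-- The maximal function is bounded on `L^q` for `q > 1`. -/
lemma exists_lintegral_dyadicMaximal_rpow_le {d : ℕ} (hd : 1 ≤ d) {q : ℝ} (hq : 1 < q) :
    ∃ C : ℝ≥0∞, C ≠ ∞ ∧ ∀ H : Rd d → ℝ, Measurable H → (∀ y, 0 ≤ H y) → ∀ B : ℝ,
      (∀ y, H y ≤ B) →
      ∫⁻ x, dyadicMaximal (fun y => ENNReal.ofReal (H y)) x ^ q ≤
        C * ∫⁻ y, ENNReal.ofReal (H y) ^ q := by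
  have : NeZero d := ⟨by omega⟩
  set v := volume (Metric.ball (0 : Rd d) 1) with hv
  have hv_top : v ≠ ∞ := measure_ball_lt_top.ne
  have hw : 0 < v.toReal :=
    ENNReal.toReal_pos (Metric.measure_ball_pos _ _ one_pos).ne' hv_top
  set w := v.toReal with hw_def
  set K : ℝ≥0∞ := ENNReal.ofReal (5 ^ d) * v with hK
  have hK_top : K ≠ ∞ := ENNReal.mul_ne_top ENNReal.ofReal_ne_top hv_top
  clear_value K
  have hq1 : 0 < q - 1 := by linarith
  refine ⟨ENNReal.ofReal q * (K * ENNReal.ofReal (2 * ((2 * w) ^ (q - 1) / (q - 1)))),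
    ENNReal.mul_ne_top ENNReal.ofReal_ne_top (ENNReal.mul_ne_top hK_top ENNReal.ofReal_ne_top),
    fun H hH hH0 B hB => ?_⟩
  set h : Rd d → ℝ≥0∞ := fun y => ENNReal.ofReal (H y) with hh
  have hhm : Measurable h := hH.ennreal_ofReal
  have hfin : ∀ x, dyadicMaximal h x ≠ ∞ := fun x => ((dyadicMaximal_le_of_le hd
    (fun y => ENNReal.ofReal_le_ofReal (hB y)) x).trans_lt
    (ENNReal.mul_lt_top ENNReal.ofReal_lt_top hv_top.lt_top)).ne
  have hlevel : ∀ l ∈ Ioi (0 : ℝ), volume {x | l < (dyadicMaximal h x).toReal} *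
      ENNReal.ofReal (l ^ (q - 1)) ≤
      ∫⁻ y, K * (h y * (Ioo 0 (2 * w * H y)).indicator
        (fun l => ENNReal.ofReal (2 * l ^ (q - 1 - 1))) l) := by
    intro l hl
    have hl : 0 < l := hl
    set S : Set (Rd d) := {y | l < 2 * w * H y} with hS
    have hSm : MeasurableSet S := measurableSet_lt measurable_const (hH.const_mul _)
    have hset : {x | l < (dyadicMaximal h x).toReal} = {x | ENNReal.ofReal l < dyadicMaximal h x} := by
      ext x
      exact (ENNReal.ofReal_lt_iff_lt_toReal hl.le (hfin x)).symm
    calc _ ≤ K * ((∫⁻ y, S.indicator h y) / ENNReal.ofReal (l / 2)) *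
          ENNReal.ofReal (l ^ (q - 1)) := by
          rw [hset, hK]
          gcongr
          exact (measure_mono (setOf_lt_dyadicMaximal_subset hd hH hl)).trans
            (volume_lt_dyadicMaximal_le hd _ (half_pos hl))
      _ = K * ((∫⁻ y, S.indicator h y) * ENNReal.ofReal (2 * l ^ (q - 1 - 1))) := by
          rw [mul_assoc, div_eq_mul_inv, ← ENNReal.ofReal_inv_of_pos (half_pos hl), mul_assoc,
            ← ENNReal.ofReal_mul (by positivity)]
          congr 3
          rw [rpow_sub_one hl.ne' (q - 1)]
          field_simp
      _ = _ := by
          rw [← lintegral_mul_const _ (hhm.indicator hSm), ← lintegral_const_mul' _ _ hK_top]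
          refine lintegral_congr fun y => ?_
          congr 1
          by_cases hy : y ∈ S
          · rw [indicator_of_mem hy, indicator_of_mem (show l ∈ Ioo 0 (2 * w * H y) from ⟨hl, hy⟩)]
          · rw [indicator_of_notMem hy, indicator_of_notMem fun h' => hy h'.2, zero_mul, mul_zero]
  calc ∫⁻ x, dyadicMaximal h x ^ q
      = ∫⁻ x, ENNReal.ofReal ((dyadicMaximal h x).toReal ^ q) := by
        refine lintegral_congr fun x => ?_
        rw [← ENNReal.ofReal_rpow_of_nonneg ENNReal.toReal_nonneg (by linarith),
          ENNReal.ofReal_toReal (hfin x)]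
    _ = ENNReal.ofReal q * ∫⁻ l in Ioi (0 : ℝ), volume {x | l < (dyadicMaximal h x).toReal} *
          ENNReal.ofReal (l ^ (q - 1)) :=
        lintegral_rpow_eq_lintegral_meas_lt_mul _ (ae_of_all _ fun _ => ENNReal.toReal_nonneg)
          (measurable_dyadicMaximal hhm).ennreal_toReal.aemeasurable (by linarith)
    _ ≤ ENNReal.ofReal q * ∫⁻ l in Ioi (0 : ℝ), ∫⁻ y, K * (h y *
          (Ioo 0 (2 * w * H y)).indicator (fun l => ENNReal.ofReal (2 * l ^ (q - 1 - 1))) l) := by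
        exact mul_le_mul' le_rfl (setLIntegral_mono' measurableSet_Ioi hlevel)
    _ = ENNReal.ofReal q * ∫⁻ y, ∫⁻ l in Ioi (0 : ℝ), K * (h y *
          (Ioo 0 (2 * w * H y)).indicator (fun l => ENNReal.ofReal (2 * l ^ (q - 1 - 1))) l) := by
        congr 1
        apply lintegral_lintegral_swap
        apply Measurable.aemeasurable
        refine Measurable.const_mul ((hhm.comp measurable_snd).mul ?_) _
        change Measurable ({p : ℝ × Rd d | 0 < p.1 ∧ p.1 < 2 * w * H p.2}.indicator
          fun p => ENNReal.ofReal (2 * p.1 ^ (q - 1 - 1)))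
        refine Measurable.indicator (by fun_prop) (MeasurableSet.inter
          (measurableSet_lt measurable_const measurable_fst)
          (measurableSet_lt measurable_fst ((hH.comp measurable_snd).const_mul _)))
    _ ≤ ENNReal.ofReal q * ∫⁻ y, K * ENNReal.ofReal (2 * ((2 * w) ^ (q - 1) / (q - 1))) *
          h y ^ q := by
        gcongr with y
        rw [lintegral_const_mul' _ _ hK_top, lintegral_const_mul' _ _ ENNReal.ofReal_ne_top,
          lintegral_indicator measurableSet_Ioo, mul_assoc K]
        refine mul_le_mul' le_rfl ?_
        have hc : 0 ≤ 2 * w * H y := mul_nonneg (by positivity) (hH0 y)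
        calc _ ≤ h y * ∫⁻ l in Ioc 0 (2 * w * H y), ENNReal.ofReal 2 *
              ENNReal.ofReal (l ^ (q - 1 - 1)) := by
              refine mul_le_mul' le_rfl ?_
              simp_rw [← ENNReal.ofReal_mul (zero_le_two (α := ℝ))]
              refine lintegral_mono' ?_ le_rfl
              exact (Measure.restrict_mono_measure Measure.restrict_le_self _).trans
                (Measure.restrict_mono_set _ Ioo_subset_Ioc_self)
          _ = _ := by
              rw [lintegral_const_mul' _ _ ENNReal.ofReal_ne_top, lintegral_Ioc_rpow hq1 hc,
                ← ENNReal.ofReal_mul zero_le_two, hh, ENNReal.ofReal_rpow_of_nonneg (hH0 y) (by linarith),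
                ← ENNReal.ofReal_mul (hH0 y), ← ENNReal.ofReal_mul (by positivity),
                mul_rpow (by positivity) (hH0 y)]
              congr 1
              have : H y ^ q = H y ^ (q - 1) * H y := by
                rcases (hH0 y).eq_or_lt with h0 | h0
                · rw [← h0, zero_rpow (by linarith), mul_zero]
                · rw [← rpow_add_one h0.ne', sub_add_cancel]
              rw [this]
              ring
    _ = _ := by
        rw [lintegral_const_mul' _ _ (ENNReal.mul_ne_top hK_top ENNReal.ofReal_ne_top), ← mul_assoc]

/-! ### Hedberg's inequality -/

lemma lintegral_riesz_le_lintegral_ball {d : ℕ} {a : ℝ} (ha : 0 < a) {h : Rd d → ℝ≥0∞}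
    (hh : Measurable h) (x : Rd d) :
    ∫⁻ y, ENNReal.ofReal (‖x - y‖ ^ (-a)) * h y ≤
      ENNReal.ofReal a * ∫⁻ r in Ioi (0 : ℝ), ENNReal.ofReal (r ^ (-a - 1)) *
        ∫⁻ y in Metric.ball x r, h y := by
  calc ∫⁻ y, ENNReal.ofReal (‖x - y‖ ^ (-a)) * h y
      ≤ ∫⁻ y, ENNReal.ofReal a * ∫⁻ r in Ioi (0 : ℝ), ENNReal.ofReal (r ^ (-a - 1)) *
          (Metric.ball x r).indicator h y := by
        refine lintegral_mono fun y => ?_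
        rcases (norm_nonneg (x - y)).eq_or_lt with h0 | h0
        · simp only [← h0]
          rw [zero_rpow (by linarith), ENNReal.ofReal_zero, zero_mul]
          exact zero_le
        · calc _ = ENNReal.ofReal a * ∫⁻ r in Ioi ‖x - y‖, ENNReal.ofReal (r ^ (-a - 1)) * h y := by
                rw [lintegral_mul_const _ (by fun_prop), lintegral_Ioi_rpow ha h0, ← mul_assoc,
                  ← ENNReal.ofReal_mul ha.le, mul_div_cancel₀ _ ha.ne']
            _ = ENNReal.ofReal a * ∫⁻ r in Ioi ‖x - y‖, ENNReal.ofReal (r ^ (-a - 1)) *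
                  (Metric.ball x r).indicator h y := by
                congr 1
                refine setLIntegral_congr_fun measurableSet_Ioi fun r hr => ?_
                rw [indicator_of_mem]
                rw [Metric.mem_ball, dist_comm, dist_eq_norm]
                exact hr
            _ ≤ _ := by
                gcongr
    _ = ENNReal.ofReal a * ∫⁻ y, ∫⁻ r in Ioi (0 : ℝ), ENNReal.ofReal (r ^ (-a - 1)) *
          (Metric.ball x r).indicator h y := lintegral_const_mul' _ _ ENNReal.ofReal_ne_top
    _ = ENNReal.ofReal a * ∫⁻ r in Ioi (0 : ℝ), ∫⁻ y, ENNReal.ofReal (r ^ (-a - 1)) *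
          (Metric.ball x r).indicator h y := by
        congr 1
        apply lintegral_lintegral_swap
        apply Measurable.aemeasurable
        refine Measurable.mul (by fun_prop) ?_
        change Measurable ({p : Rd d × ℝ | dist p.1 x < p.2}.indicator fun p => h p.1)
        exact (hh.comp measurable_fst).indicator (measurableSet_lt (by fun_prop) measurable_snd)
    _ = _ := by
        congr 1
        refine lintegral_congr fun r => ?_
        rw [lintegral_const_mul' _ _ ENNReal.ofReal_ne_top,
          lintegral_indicator Metric.isOpen_ball.measurableSet]

lemma lintegral_ball_le_rpow {d : ℕ} (hd : 1 ≤ d) {q : ℝ} (hq : 1 < q) {h : Rd d → ℝ≥0∞}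
    (hh : Measurable h) (x : Rd d) {r : ℝ} (hr : 0 < r) :
    ∫⁻ y in Metric.ball x r, h y ≤ ENNReal.ofReal (r ^ (d - d / q : ℝ)) *
      (volume (Metric.ball (0 : Rd d) 1) ^ (1 - 1 / q) * (∫⁻ y, h y ^ q) ^ (1 / q)) := by
  have hconj : q.HolderConjugate (q / (q - 1)) := Real.HolderConjugate.conjExponent hq
  have hexp : 1 / (q / (q - 1)) = 1 - 1 / q := by
    field_simp
  have hexp0 : 0 ≤ 1 - 1 / q := by
    rw [sub_nonneg, div_le_one (by linarith)]; exact hq.le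
  have key := ENNReal.lintegral_mul_le_Lp_mul_Lq (volume.restrict (Metric.ball x r)) hconj
    hh.aemeasurable (aemeasurable_const (b := (1 : ℝ≥0∞)))
  simp only [Pi.mul_apply, mul_one, ENNReal.one_rpow, lintegral_one, Measure.restrict_apply_univ,
    hexp] at key
  refine key.trans ?_
  rw [volume_ball_eq hd x hr.le, ENNReal.mul_rpow_of_nonneg _ _ hexp0,
    ENNReal.ofReal_rpow_of_nonneg (by positivity) hexp0, ← rpow_natCast, ← rpow_mul hr.le,
    mul_sub, mul_one, mul_one_div, mul_comm, mul_assoc]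
  gcongr
  exact Measure.restrict_le_self

lemma exists_lintegral_riesz_le {d : ℕ} (hd : 1 ≤ d) {q α : ℝ} (hq : 1 < q) (hα : 0 < α)
    (hαq : α < d / q) :
    ∃ A : ℝ, 0 ≤ A ∧ ∀ h : Rd d → ℝ≥0∞, Measurable h → ∀ x, ∀ R > 0,
      ∫⁻ y, ENNReal.ofReal (‖x - y‖ ^ (-(d - α))) * h y ≤
        ENNReal.ofReal A * (ENNReal.ofReal (R ^ α) * dyadicMaximal h x +
          ENNReal.ofReal (R ^ (-(d / q - α))) * (∫⁻ y, h y ^ q) ^ (1 / q)) := by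
  have : NeZero d := ⟨by omega⟩
  have hd0 : (0 : ℝ) < d := by exact_mod_cast hd
  set a : ℝ := d - α with ha_def
  have ha : 0 < a := by
    have : (d : ℝ) / q < d := div_lt_self hd0 hq
    rw [ha_def]; linarith
  set b : ℝ := d / q - α with hb_def
  have hb : 0 < b := by rw [hb_def]; linarith
  set v := volume (Metric.ball (0 : Rd d) 1) with hv
  have hv_top : v ≠ ∞ := measure_ball_lt_top.ne
  have hvq : v ^ (1 - 1 / q) ≠ ∞ := ENNReal.rpow_ne_top_of_nonneg
    (by rw [sub_nonneg, div_le_one (by linarith)]; exact hq.le) hv_top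
  set V := (v ^ (1 - 1 / q)).toReal with hV_def
  have hV : v ^ (1 - 1 / q) = ENNReal.ofReal V := (ENNReal.ofReal_toReal hvq).symm
  have hV0 : 0 ≤ V := ENNReal.toReal_nonneg
  refine ⟨a * (2 ^ d / α + V / b), by positivity, fun h hh x R hR => ?_⟩
  set M := dyadicMaximal h x
  set N := (∫⁻ y, h y ^ q) ^ (1 / q)
  have hnear : ∫⁻ r in Ioc 0 R, ENNReal.ofReal (r ^ (-a - 1)) * ∫⁻ y in Metric.ball x r, h y ≤
      ENNReal.ofReal (2 ^ d / α) * (ENNReal.ofReal (R ^ α) * M) := by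
    calc _ ≤ ∫⁻ r in Ioc 0 R, ENNReal.ofReal (2 ^ d) * ENNReal.ofReal (r ^ (α - 1)) * M := by
          refine setLIntegral_mono' measurableSet_Ioc fun r hr => ?_
          have hr : 0 < r := hr.1
          calc _ ≤ ENNReal.ofReal (r ^ (-a - 1)) * (ENNReal.ofReal ((2 * r) ^ d) * M) := by
                gcongr
                exact lintegral_ball_le_dyadicMaximal h x hr
            _ = _ := by
                rw [← mul_assoc, ← ENNReal.ofReal_mul (by positivity),
                  ← ENNReal.ofReal_mul (by positivity), mul_pow, mul_left_comm,
                  ← rpow_natCast r, ← rpow_add hr]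
                congr 4
                rw [ha_def]; ring
      _ = _ := by
          rw [lintegral_mul_const _ (by fun_prop), lintegral_const_mul' _ _ ENNReal.ofReal_ne_top,
            lintegral_Ioc_rpow hα hR.le, ← mul_assoc, ← ENNReal.ofReal_mul (by positivity),
            ← ENNReal.ofReal_mul (by positivity)]
          congr 2
          ring
  have hfar : ∫⁻ r in Ioi R, ENNReal.ofReal (r ^ (-a - 1)) * ∫⁻ y in Metric.ball x r, h y ≤
      ENNReal.ofReal (V / b) * (ENNReal.ofReal (R ^ (-b)) * N) := by
    calc _ ≤ ∫⁻ r in Ioi R, ENNReal.ofReal V * ENNReal.ofReal (r ^ (-b - 1)) * N := by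
          refine setLIntegral_mono' measurableSet_Ioi fun r hr => ?_
          have hr : 0 < r := hR.trans hr
          calc _ ≤ ENNReal.ofReal (r ^ (-a - 1)) *
                (ENNReal.ofReal (r ^ (d - d / q : ℝ)) * (ENNReal.ofReal V * N)) := by
                gcongr
                rw [← hV]
                exact lintegral_ball_le_rpow hd hq hh x hr
            _ = _ := by
                rw [← mul_assoc, ← ENNReal.ofReal_mul (by positivity), ← rpow_add hr, ← mul_assoc,
                  mul_comm (ENNReal.ofReal V)]
                congr 4
                rw [ha_def, hb_def]; ring
      _ = _ := by
          rw [lintegral_mul_const _ (by fun_prop), lintegral_const_mul' _ _ ENNReal.ofReal_ne_top,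
            lintegral_Ioi_rpow hb hR, ← mul_assoc, ← ENNReal.ofReal_mul (by positivity),
            ← ENNReal.ofReal_mul (by positivity)]
          congr 2
          ring
  refine (lintegral_riesz_le_lintegral_ball ha hh x).trans ?_
  rw [ENNReal.ofReal_mul ha.le, mul_assoc]
  gcongr
  rw [← Ioc_union_Ioi_eq_Ioi hR.le]
  refine (lintegral_union_le _ _ _).trans ((add_le_add hnear hfar).trans ?_)
  rw [mul_add]
  gcongr
  · exact le_add_of_nonneg_right (by positivity)
  · exact le_add_of_nonneg_left (by positivity)

/-- Optimisation of a two-term bound over a free scale. -/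
lemma le_rpow_mul_rpow_of_forall_scale {F A m n u w : ℝ} (hA : 0 ≤ A) (hm : 0 ≤ m) (hn : 0 ≤ n)
    (hu : 0 < u) (hw : 0 < w) (hF : ∀ R > 0, F ≤ A * (R ^ u * m + R ^ (-w) * n)) :
    F ≤ 2 * A * (m ^ (w / (u + w)) * n ^ (u / (u + w))) := by
  have huw : 0 < u + w := by positivity
  have hδ : ∀ δ > 0, F ≤ 2 * A * ((m + δ) ^ (w / (u + w)) * (n + δ) ^ (u / (u + w))) := by
    intro δ hδ
    have hm' : 0 < m + δ := by positivity
    have hn' : 0 < n + δ := by positivity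
    have h1 : (((n + δ) / (m + δ)) ^ (1 / (u + w))) ^ u * (m + δ) =
        (m + δ) ^ (w / (u + w)) * (n + δ) ^ (u / (u + w)) := by
      have : w / (u + w) = 1 - u / (u + w) := by field_simp; ring
      rw [← rpow_mul (by positivity), div_rpow hn'.le hm'.le, this, rpow_sub hm', rpow_one,
        one_div_mul_eq_div]
      ring
    have h2 : (((n + δ) / (m + δ)) ^ (1 / (u + w))) ^ (-w) * (n + δ) =
        (m + δ) ^ (w / (u + w)) * (n + δ) ^ (u / (u + w)) := by
      have : u / (u + w) = 1 - w / (u + w) := by field_simp; ring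
      rw [← rpow_mul (by positivity), this, rpow_sub hn', rpow_one, mul_neg, rpow_neg (by positivity),
        div_rpow hn'.le hm'.le, one_div_mul_eq_div, inv_div]
      ring
    calc F ≤ A * ((((n + δ) / (m + δ)) ^ (1 / (u + w))) ^ u * m +
          (((n + δ) / (m + δ)) ^ (1 / (u + w))) ^ (-w) * n) := hF _ (by positivity)
      _ ≤ A * ((((n + δ) / (m + δ)) ^ (1 / (u + w))) ^ u * (m + δ) +
          (((n + δ) / (m + δ)) ^ (1 / (u + w))) ^ (-w) * (n + δ)) := by
        gcongr <;> linarith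
      _ = _ := by rw [h1, h2]; ring
  have hcont : Continuous fun δ : ℝ =>
      2 * A * ((m + δ) ^ (w / (u + w)) * (n + δ) ^ (u / (u + w))) := by
    have h1 : Continuous fun δ : ℝ => (m + δ) ^ (w / (u + w)) :=
      (continuous_const.add continuous_id).rpow_const fun _ => Or.inr (by positivity)
    have h2 : Continuous fun δ : ℝ => (n + δ) ^ (u / (u + w)) :=
      (continuous_const.add continuous_id).rpow_const fun _ => Or.inr (by positivity)
    fun_prop
  have hlim := (hcont.tendsto 0).mono_left (nhdsWithin_le_nhds (s := Ioi 0))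
  simp only [add_zero] at hlim
  exact ge_of_tendsto hlim (eventually_mem_nhdsWithin.mono fun δ h => hδ δ h)

/-- Hedberg's pointwise bound of the Riesz potential by the maximal function. -/
lemma exists_lintegral_riesz_le_dyadicMaximal_rpow {d : ℕ} (hd : 1 ≤ d) {q α : ℝ} (hq : 1 < q)
    (hα : 0 < α) (hαq : α < d / q) :
    ∃ A : ℝ, 0 ≤ A ∧ ∀ h : Rd d → ℝ≥0∞, Measurable h → ∫⁻ y, h y ^ q ≠ ∞ → ∀ x,
      dyadicMaximal h x ≠ ∞ →
      ∫⁻ y, ENNReal.ofReal (‖x - y‖ ^ (-(d - α))) * h y ≤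
        ENNReal.ofReal A * (dyadicMaximal h x ^ (1 - α * q / d) *
          ((∫⁻ y, h y ^ q) ^ (1 / q)) ^ (α * q / d)) := by
  obtain ⟨A, hA, hle⟩ := exists_lintegral_riesz_le hd hq hα hαq
  have hd0 : (0 : ℝ) < d := by exact_mod_cast hd
  have hq0 : 0 < q := by linarith
  refine ⟨2 * A, by positivity, fun h hh hfin x hMfin => ?_⟩
  set M := dyadicMaximal h x
  have hNfin : (∫⁻ y, h y ^ q) ^ (1 / q) ≠ ∞ :=
    ENNReal.rpow_ne_top_of_nonneg (by positivity) hfin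
  set N := (∫⁻ y, h y ^ q) ^ (1 / q)
  have hM : M = ENNReal.ofReal M.toReal := (ENNReal.ofReal_toReal hMfin).symm
  have hN : N = ENNReal.ofReal N.toReal := (ENNReal.ofReal_toReal hNfin).symm
  have hle' : ∀ R > 0, ∫⁻ y, ENNReal.ofReal (‖x - y‖ ^ (-(d - α))) * h y ≤
      ENNReal.ofReal (A * (R ^ α * M.toReal + R ^ (-(d / q - α)) * N.toReal)) := by
    intro R hR
    refine (hle h hh x R hR).trans_eq ?_
    rw [ENNReal.ofReal_mul hA, ENNReal.ofReal_add (by positivity) (by positivity),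
      ENNReal.ofReal_mul (by positivity), ENNReal.ofReal_mul (by positivity), ← hM, ← hN]
  have hI := ((hle' 1 one_pos).trans_lt ENNReal.ofReal_lt_top).ne
  have key := le_rpow_mul_rpow_of_forall_scale (m := M.toReal) (n := N.toReal) hA
    ENNReal.toReal_nonneg ENNReal.toReal_nonneg hα (sub_pos.2 hαq)
    fun R hR => ENNReal.toReal_le_of_le_ofReal (by positivity) (hle' R hR)
  have e1 : (d / q - α) / (α + (d / q - α)) = 1 - α * q / d := by
    rw [add_sub_cancel]; field_simp
  have e2 : α / (α + (d / q - α)) = α * q / d := by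
    rw [add_sub_cancel]; field_simp
  have e0 : 0 ≤ 1 - α * q / d := by
    rw [← e1, add_sub_cancel]
    exact div_nonneg (by linarith) (by positivity)
  rw [e1, e2] at key
  refine ((ENNReal.le_ofReal_iff_toReal_le hI (by positivity)).2 key).trans_eq ?_
  rw [ENNReal.ofReal_mul (mul_nonneg zero_le_two hA),
    ENNReal.ofReal_mul (rpow_nonneg ENNReal.toReal_nonneg _),
    ← ENNReal.ofReal_rpow_of_nonneg ENNReal.toReal_nonneg e0,
    ← ENNReal.ofReal_rpow_of_nonneg ENNReal.toReal_nonneg (by positivity), ← hM, ← hN]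

/-- the Hardy–Littlewood–Sobolev inequality ‖f‖_{L^p} ≲ ‖Λ^α f‖_{L^q}. -/
theorem riesz_potential_Lp (d : ℕ) (hd : 1 ≤ d) (p q α : ℝ)
    (hq : 1 < q) (hp2 : 2 < p) (hα : 0 < α)
    (hpq : 1 / p + α / d = 1 / q) :
    ∃ C > (0:ℝ), ∀ f : SchwartzMap (Rd d) ℂ,
      eLpNorm (⇑f) (ENNReal.ofReal p) volume ≤
        ENNReal.ofReal C * eLpNorm (LamC α ⇑f) (ENNReal.ofReal q) volume := by
  have hd0 : (0 : ℝ) < d := by exact_mod_cast hd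
  have hp0 : 0 < p := by linarith
  have hq0 : 0 < q := by linarith
  have hαq : α < d / q := by
    have : 0 < 1 / p := by positivity
    rw [div_eq_mul_one_div, mul_comm, ← div_lt_iff₀ hd0]
    linarith
  have hαd : α < d := hαq.trans (div_lt_self hd0 hq)
  have hexp : α * q / d = 1 - q / p := by
    have : α / d = 1 / q - 1 / p := by linarith
    rw [mul_div_right_comm, this]
    field_simp
  have hqp : q ≤ p := by
    have : 0 < α * q / d := by positivity
    rw [hexp, sub_pos, div_lt_one hp0] at this
    exact this.le
  obtain ⟨C, hC⟩ := exists_enorm_le_lintegral_riesz hd hα hαd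
  obtain ⟨A, -, hA⟩ := exists_lintegral_riesz_le_dyadicMaximal_rpow hd hq hα hαq
  obtain ⟨K, hK, hKle⟩ := exists_lintegral_dyadicMaximal_rpow_le hd hq
  set D : ℝ≥0∞ := ENNReal.ofReal C * ENNReal.ofReal A with hD_def
  have hD : D ≠ ∞ := ENNReal.mul_ne_top ENNReal.ofReal_ne_top ENNReal.ofReal_ne_top
  have hDK : D * K ^ (1 / p) ≠ ∞ :=
    ENNReal.mul_ne_top hD (ENNReal.rpow_ne_top_of_nonneg (by positivity) hK)
  refine ⟨(D * K ^ (1 / p)).toReal + 1, by positivity, fun f => ?_⟩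
  set g := LamC α ⇑f with hg_def
  have hg : Continuous g := continuous_LamC hα f
  obtain ⟨B, hB⟩ := exists_norm_LamC_le α f
  rw [eLpNorm_eq_lintegral_rpow_enorm_toReal (by simpa using hp0) ENNReal.ofReal_ne_top,
    eLpNorm_eq_lintegral_rpow_enorm_toReal (by simpa using hq0) ENNReal.ofReal_ne_top,
    ENNReal.toReal_ofReal hp0.le, ENNReal.toReal_ofReal hq0.le]
  rcases eq_or_ne (∫⁻ y, ‖g y‖ₑ ^ q) ∞ with htop | htop
  · rw [htop, ENNReal.top_rpow_of_pos (by positivity), ENNReal.mul_top]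
    · exact le_top
    · simp only [ne_eq, ENNReal.ofReal_eq_zero, not_le]
      positivity
  set M := dyadicMaximal fun y => ‖g y‖ₑ with hM_def
  have hMfin : ∀ x, M x ≠ ∞ := fun x => by
    refine ((dyadicMaximal_le_of_le hd (B := ENNReal.ofReal B) (fun y => ?_) x).trans_lt
      (ENNReal.mul_lt_top ENNReal.ofReal_lt_top measure_ball_lt_top)).ne
    rw [← ofReal_norm]
    exact ENNReal.ofReal_le_ofReal (hB y)
  set N := (∫⁻ y, ‖g y‖ₑ ^ q) ^ (1 / q) with hN_def
  have hNq : ∫⁻ y, ‖g y‖ₑ ^ q = N ^ q := by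
    rw [hN_def, ← ENNReal.rpow_mul, one_div_mul_cancel hq0.ne', ENNReal.rpow_one]
  have hM : ∫⁻ x, M x ^ q ≤ K * N ^ q := by
    have := hKle (fun y => ‖g y‖) hg.norm.measurable (fun _ => norm_nonneg _) B hB
    simp only [ofReal_norm] at this
    exact this.trans_eq (by rw [hNq])
  have hpt : ∀ x, ‖f x‖ₑ ^ p ≤ D ^ p * N ^ (p - q) * M x ^ q := by
    intro x
    have h1 : ‖f x‖ₑ ≤ D * (M x ^ (q / p) * N ^ (1 - q / p)) := by
      refine (hC f x).trans ?_
      rw [hD_def, mul_assoc]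
      gcongr
      have := hA _ hg.measurable.enorm htop x (hMfin x)
      rwa [hexp, sub_sub_cancel] at this
    clear_value D N M
    refine (ENNReal.rpow_le_rpow h1 hp0.le).trans_eq ?_
    rw [ENNReal.mul_rpow_of_nonneg _ _ hp0.le, ENNReal.mul_rpow_of_nonneg _ _ hp0.le,
      ← ENNReal.rpow_mul, ← ENNReal.rpow_mul, div_mul_cancel₀ _ hp0.ne', sub_mul,
      div_mul_cancel₀ _ hp0.ne', one_mul]
    ring
  have hNfin : N ≠ ∞ := ENNReal.rpow_ne_top_of_nonneg (by positivity) htop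
  clear_value D N M
  have hDN : D ^ p * N ^ (p - q) ≠ ∞ := ENNReal.mul_ne_top
    (ENNReal.rpow_ne_top_of_nonneg hp0.le hD)
    (ENNReal.rpow_ne_top_of_nonneg (sub_nonneg.2 hqp) hNfin)
  calc (∫⁻ x, ‖f x‖ₑ ^ p) ^ (1 / p)
      ≤ (D ^ p * N ^ (p - q) * (K * N ^ q)) ^ (1 / p) := by
        gcongr
        refine (lintegral_mono hpt).trans ?_
        rw [lintegral_const_mul' _ _ hDN]
        gcongr
    _ = (D ^ p * K * N ^ p) ^ (1 / p) := by
        congr 1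
        rw [← sub_add_cancel p q, ENNReal.rpow_add_of_nonneg (x := N) _ _ (sub_nonneg.2 hqp) hq0.le]
        simp only [sub_add_cancel]
        ring
    _ = D * K ^ (1 / p) * N := by
        rw [ENNReal.mul_rpow_of_nonneg _ _ (by positivity),
          ENNReal.mul_rpow_of_nonneg _ _ (by positivity), ← ENNReal.rpow_mul, ← ENNReal.rpow_mul,
          mul_one_div_cancel hp0.ne', ENNReal.rpow_one, ENNReal.rpow_one]
    _ ≤ _ := by
        gcongr
        rw [ENNReal.ofReal_add ENNReal.toReal_nonneg zero_le_one, ENNReal.ofReal_toReal hDK]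
        exact le_self_add
end
end

section
/- Let d ≥ 1, α ≥ 0, 1 ≤ p ≤ q ≤ ∞ and 0 < K₁ ≤ K₂. There exist constants C₁, C₂ > 0, depending only on α, p, q, d, K₁ and K₂, such that for every integer j and every Schwartz function f : ℝ^d → ℂ whose Fourier transform is supported in {ξ ∈ ℝ^d : K₁ 2^j ≤ |ξ| ≤ K₂ 2^j}, the function g := 𝓕^{-1}(ξ ↦ |ξ|^{2α} 𝓕f(ξ)) satisfies C₁ 2^{2jα} ‖f‖_{L^q(ℝ^d)} ≤ ‖g‖_{L^q(ℝ^d)} ≤ C₂ 2^{2jα + jd(1/p − 1/q)} ‖f‖_{L^p(ℝ^d)}. -/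
open MeasureTheory Real Set
open scoped FourierTransform ENNReal

noncomputable section

section FourierMultiplier

open scoped SchwartzMap RealInnerProductSpace

/-- On an annulus, a power of the norm agrees with a Schwartz function. -/
theorem exists_schwartz_eq_norm_rpow {V : Type*} [NormedAddCommGroup V] [InnerProductSpace ℝ V]
    [FiniteDimensional ℝ V] (β : ℝ) {a b : ℝ} (ha : 0 < a) (hab : a ≤ b) :
    ∃ M : 𝓢(V, ℂ), ∀ ξ : V, a ≤ ‖ξ‖ → ‖ξ‖ ≤ b → M ξ = ((‖ξ‖ ^ β : ℝ) : ℂ) := by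
  let b₁ : ContDiffBump (0 : V) := ⟨b, b + 1, ha.trans_le hab, by linarith⟩
  let b₂ : ContDiffBump (0 : V) := ⟨a / 4, a / 2, by linarith, by linarith⟩
  let m : V → ℝ := fun ξ ↦ b₁ ξ * ((1 - b₂ ξ) * ‖ξ‖ ^ β)
  have hm : ContDiff ℝ (⊤ : ℕ∞) m := by
    rw [contDiff_iff_contDiffAt]
    intro ξ
    rcases eq_or_ne ξ 0 with rfl | hξ
    · have : m =ᶠ[nhds 0] fun _ ↦ 0 := by
        filter_upwards [b₂.eventuallyEq_one] with ξ hξ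
        simp [m, hξ]
      exact contDiffAt_const.congr_of_eventuallyEq this
    · exact b₁.contDiffAt.mul ((contDiffAt_const.sub b₂.contDiffAt).mul
        ((contDiffAt_norm ℝ hξ).rpow_const_of_ne (norm_ne_zero_iff.2 hξ)))
  have hcs : HasCompactSupport m := b₁.hasCompactSupport.mul_right
  have hcs' : HasCompactSupport fun ξ ↦ (m ξ : ℂ) := hcs.comp_left (g := Complex.ofReal) rfl
  refine ⟨hcs'.toSchwartzMap (Complex.ofRealCLM.contDiff.comp hm), fun ξ h1 h2 ↦ ?_⟩
  have e1 : b₁ ξ = 1 := b₁.one_of_mem_closedBall (by simpa using h2)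
  have e2 : b₂ ξ = 0 := b₂.zero_of_le_dist (by simp [b₂]; linarith)
  change ((m ξ : ℝ) : ℂ) = _
  simp [m, e1, e2]

variable {V : Type*} [NormedAddCommGroup V] [InnerProductSpace ℝ V] [FiniteDimensional ℝ V]
  [MeasurableSpace V] [BorelSpace V]

/-- Jensen's inequality for the measure with density `k`. -/
theorem lintegral_mul_rpow_le {X : Type*} [MeasurableSpace X] {μ : Measure X} {k f : X → ℝ≥0∞}
    (hk : AEMeasurable k μ) (hf : AEMeasurable f μ) {P : ℝ} (hP : 1 ≤ P) :
    ∫⁻ y, k y * f y ∂μ ≤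
      (∫⁻ y, k y ∂μ) ^ (1 - P⁻¹) * (∫⁻ y, k y * f y ^ P ∂μ) ^ P⁻¹ := by
  have hP0 : 0 < P := by linarith
  have hP1 : 0 ≤ 1 - P⁻¹ := sub_nonneg.2 (inv_le_one_of_one_le₀ hP)
  have hPi : 0 ≤ P⁻¹ := by positivity
  refine le_trans (le_of_eq (lintegral_congr fun y ↦ ?_))
    (ENNReal.lintegral_mul_norm_pow_le hk (hk.mul (hf.pow_const P)) hP1 hPi (by ring))
  rw [Pi.mul_apply, ENNReal.mul_rpow_of_nonneg _ _ hPi, ← mul_assoc,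
    ← ENNReal.rpow_add_of_nonneg _ _ hP1 hPi, sub_add_cancel, ENNReal.rpow_one,
    ENNReal.rpow_rpow_inv hP0.ne']

/-- Young-type inequality for a nonnegative kernel with mass at most `D` and supremum at most
`L * D`. -/
theorem eLpNorm_lintegral_kernel_le {k f : V → ℝ≥0∞} (hk : Measurable k) (hf : Measurable f)
    {D L : ℝ≥0∞} (hkD : ∫⁻ z, k z ≤ D) (hkL : ∀ z, k z ≤ L * D)
    {p q : ℝ≥0∞} (hp : 1 ≤ p) (hpq : p ≤ q) :
    eLpNorm (fun x ↦ ∫⁻ y, k (x - y) * f y) q volume ≤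
      D * L ^ (p⁻¹.toReal - q⁻¹.toReal) * eLpNorm f p volume := by
  have hkx (x : V) : ∫⁻ y, k (x - y) ≤ D := (lintegral_sub_left_eq_self k x).trans_le hkD
  have hkm (x : V) : Measurable fun y ↦ k (x - y) := hk.comp (measurable_const.sub measurable_id)
  rcases eq_or_ne p ∞ with rfl | hp_top
  · obtain rfl : q = ∞ := top_le_iff.1 hpq
    simp only [ENNReal.inv_top, ENNReal.toReal_zero, sub_self, ENNReal.rpow_zero, mul_one,
      eLpNorm_exponent_top]
    refine eLpNormEssSup_le_of_ae_enorm_bound (.of_forall fun x ↦ ?_)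
    calc ∫⁻ y, k (x - y) * f y ≤ ∫⁻ y, k (x - y) * eLpNormEssSup f volume := by
          refine lintegral_mono_ae ?_
          filter_upwards [enorm_ae_le_eLpNormEssSup f volume] with y hy
          gcongr
          exact hy
      _ = (∫⁻ y, k (x - y)) * eLpNormEssSup f volume := lintegral_mul_const _ (hkm x)
      _ ≤ _ := by gcongr; exact hkx x
  have hp0 : p ≠ 0 := (one_pos.trans_le hp).ne'
  set P := p.toReal
  have hP : 1 ≤ P := by simpa using ENNReal.toReal_mono hp_top hp
  have hP0 : 0 < P := by linarith
  have hP1 : 0 ≤ 1 - P⁻¹ := sub_nonneg.2 (inv_le_one_of_one_le₀ hP)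
  have hPi : 0 ≤ P⁻¹ := by positivity
  have hpP : p⁻¹.toReal = P⁻¹ := ENNReal.toReal_inv p
  set u : V → ℝ≥0∞ := fun x ↦ ∫⁻ y, k (x - y) * f y
  set F := ∫⁻ y, f y ^ P
  set N := eLpNorm f p volume with hN
  have hNF : N = F ^ P⁻¹ := by
    rw [hN, eLpNorm_eq_lintegral_rpow_enorm_toReal hp0 hp_top, one_div]; rfl
  have hNP : N ^ P = F := by rw [hNF, ENNReal.rpow_inv_rpow hP0.ne']
  have hDD : D ^ (1 - P⁻¹) * D ^ P⁻¹ = D := by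
    rw [← ENNReal.rpow_add_of_nonneg _ _ hP1 hPi, sub_add_cancel, ENNReal.rpow_one]
  have hux (x : V) : u x ≤ D ^ (1 - P⁻¹) * (∫⁻ y, k (x - y) * f y ^ P) ^ P⁻¹ := by
    refine (lintegral_mul_rpow_le (hkm x).aemeasurable hf.aemeasurable hP).trans ?_
    gcongr
    exact hkx x
  have hsup (x : V) : u x ≤ D * L ^ P⁻¹ * N := by
    calc u x ≤ D ^ (1 - P⁻¹) * (∫⁻ y, L * D * f y ^ P) ^ P⁻¹ := by
          refine (hux x).trans ?_
          gcongr
          exact hkL _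
      _ = D ^ (1 - P⁻¹) * (L * D * F) ^ P⁻¹ := by
          rw [lintegral_const_mul _ (hf.pow_const P)]
      _ = (D ^ (1 - P⁻¹) * D ^ P⁻¹) * L ^ P⁻¹ * N := by
          rw [ENNReal.mul_rpow_of_nonneg _ _ hPi, ENNReal.mul_rpow_of_nonneg _ _ hPi, hNF]
          ring
      _ = _ := by rw [hDD]
  have h_int : ∫⁻ x, u x ^ P ≤ (D * N) ^ P := by
    calc ∫⁻ x, u x ^ P
        ≤ ∫⁻ x, D ^ (P - 1) * ∫⁻ y, k (x - y) * f y ^ P := by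
          refine lintegral_mono fun x ↦ ?_
          refine (ENNReal.rpow_le_rpow (hux x) hP0.le).trans_eq ?_
          rw [ENNReal.mul_rpow_of_nonneg _ _ hP0.le, ENNReal.rpow_inv_rpow hP0.ne',
            ← ENNReal.rpow_mul, sub_mul, inv_mul_cancel₀ hP0.ne', one_mul]
      _ = D ^ (P - 1) * ∫⁻ x, ∫⁻ y, k (x - y) * f y ^ P := by
          refine lintegral_const_mul _
            (Measurable.lintegral_prod_right' (f := fun z : V × V ↦ k (z.1 - z.2) * f z.2 ^ P) ?_)
          fun_prop
      _ = D ^ (P - 1) * ∫⁻ y, ∫⁻ x, k (x - y) * f y ^ P := by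
          rw [lintegral_lintegral_swap]
          fun_prop
      _ = D ^ (P - 1) * ∫⁻ y, (∫⁻ x, k x) * f y ^ P := by
          congr 1
          refine lintegral_congr fun y ↦ ?_
          rw [lintegral_mul_const _ (by fun_prop), lintegral_sub_right_eq_self k y]
      _ ≤ D ^ (P - 1) * (D * F) := by
          rw [lintegral_const_mul _ (by fun_prop)]
          gcongr
      _ = (D * N) ^ P := by
          rw [ENNReal.mul_rpow_of_nonneg _ _ hP0.le, hNP, ← mul_assoc]
          congr 1
          conv_lhs => rw [← ENNReal.rpow_one D, ← ENNReal.rpow_mul, one_mul]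
          rw [← ENNReal.rpow_add_of_nonneg _ _ (by linarith) zero_le_one, sub_add_cancel]
  rcases eq_or_ne q ∞ with rfl | hq_top
  · rw [hpP]
    simpa using eLpNormEssSup_le_of_ae_enorm_bound (f := u) (.of_forall hsup)
  set Q := q.toReal with hQdef
  have hPQ : P ≤ Q := ENNReal.toReal_mono hq_top hpq
  have hQ0 : 0 < Q := by linarith
  rw [eLpNorm_eq_lintegral_rpow_enorm_toReal (one_pos.trans_le (hp.trans hpq)).ne' hq_top, one_div,
    ENNReal.rpow_inv_le_iff hQ0]
  calc ∫⁻ x, u x ^ Q ≤ ∫⁻ x, (D * L ^ P⁻¹ * N) ^ (Q - P) * u x ^ P := by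
        refine lintegral_mono fun x ↦ ?_
        conv_lhs => rw [← sub_add_cancel Q P,
          ENNReal.rpow_add_of_nonneg _ _ (sub_nonneg.2 hPQ) hP0.le]
        gcongr
        exact hsup x
    _ ≤ (D * L ^ P⁻¹ * N) ^ (Q - P) * (D * N) ^ P := by
        rw [lintegral_const_mul _ ?_]
        · gcongr
        · refine (Measurable.lintegral_prod_right'
            (f := fun z : V × V ↦ k (z.1 - z.2) * f z.2) ?_).pow_const P
          fun_prop
    _ = (D * L ^ (p⁻¹.toReal - q⁻¹.toReal) * N) ^ Q := by
        rw [mul_right_comm D _ N, mul_right_comm D _ N,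
          ENNReal.mul_rpow_of_nonneg _ _ (sub_nonneg.2 hPQ), ENNReal.mul_rpow_of_nonneg _ _ hQ0.le,
          mul_right_comm, ← ENNReal.rpow_add_of_nonneg _ _ (sub_nonneg.2 hPQ) hP0.le,
          sub_add_cancel, ← ENNReal.rpow_mul, ← ENNReal.rpow_mul, hpP, ENNReal.toReal_inv q,
          ← hQdef]
        congr 2
        field_simp

/-- A dilated Fourier multiplier acts as convolution with the dilated kernel. -/
theorem eq_integral_of_fourier_eq_dilate_mul (M f g : 𝓢(V, ℂ)) {t : ℝ} (ht : 0 < t)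
    (h : ∀ ξ, 𝓕 (g : V → ℂ) ξ = M (t⁻¹ • ξ) * 𝓕 (f : V → ℂ) ξ) (x : V) :
    g x = ∫ y, f y • ((t : ℂ) ^ Module.finrank ℝ V * (𝓕⁻ M) (t • (x - y))) := by
  have hM : Integrable (fun ξ ↦ M (t⁻¹ • ξ)) (volume : Measure V) :=
    M.integrable.comp_smul (inv_ne_zero ht.ne')
  have hMx : Integrable (fun ξ ↦ 𝐞 ⟪ξ, x⟫ • M (t⁻¹ • ξ)) (volume : Measure V) := by
    refine hM.norm.mono' ?_ (.of_forall fun ξ ↦ by simp [Circle.norm_smul])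
    have : Continuous fun ξ : V ↦ 𝐞 ⟪ξ, x⟫ := by fun_prop
    exact (this.smul (M.continuous.comp (continuous_const_smul _))).aestronglyMeasurable
  have key (y : V) : 𝓕 (fun ξ ↦ 𝐞 ⟪ξ, x⟫ • M (t⁻¹ • ξ)) y
      = (t : ℂ) ^ Module.finrank ℝ V * (𝓕⁻ M) (t • (x - y)) := by
    rw [Real.fourier_eq, SchwartzMap.fourierInv_coe]
    have := Measure.integral_comp_inv_smul_of_nonneg (volume : Measure V)
      (fun η ↦ 𝐞 ⟪η, t • (x - y)⟫ • M η) ht.le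
    rw [Real.fourierInv_eq]
    convert this using 1
    · refine integral_congr_ae (.of_forall fun ξ ↦ ?_)
      simp only [smul_smul, ← AddChar.map_add_eq_mul, inner_smul_left, inner_smul_right,
        inner_sub_right]
      congr 2
      simp
      field_simp
      ring
    · simp [Complex.real_smul]
  calc g x = 𝓕⁻ (𝓕 g) x := by simp
    _ = ∫ ξ, 𝓕 (f : V → ℂ) ξ • (𝐞 ⟪ξ, x⟫ • M (t⁻¹ • ξ)) := by
        rw [SchwartzMap.fourierInv_coe, Real.fourierInv_eq]
        refine integral_congr_ae (.of_forall fun ξ ↦ ?_)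
        simp only [SchwartzMap.fourier_coe, h, Circle.smul_def, smul_eq_mul]
        ring
    _ = ∫ y, f y • 𝓕 (fun ξ ↦ 𝐞 ⟪ξ, x⟫ • M (t⁻¹ • ξ)) y := by
        simpa using! VectorFourier.integral_fourierIntegral_smul_eq_flip (L := innerₗ V)
          Real.continuous_fourierChar continuous_inner f.integrable hMx
    _ = _ := by simp_rw [key]

theorem enorm_le_lintegral_of_fourier_eq_dilate_mul (M f g : 𝓢(V, ℂ)) {t : ℝ} (ht : 0 < t)
    (h : ∀ ξ, 𝓕 (g : V → ℂ) ξ = M (t⁻¹ • ξ) * 𝓕 (f : V → ℂ) ξ) (x : V) :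
    ‖g x‖ₑ ≤
      ∫⁻ y, ENNReal.ofReal (t ^ Module.finrank ℝ V) * ‖(𝓕⁻ M) (t • (x - y))‖ₑ * ‖f y‖ₑ := by
  rw [eq_integral_of_fourier_eq_dilate_mul M f g ht h x]
  refine (enorm_integral_le_lintegral_enorm _).trans_eq (lintegral_congr fun y ↦ ?_)
  rw [smul_eq_mul, enorm_mul, enorm_mul, mul_comm]
  congr 2
  rw [← Complex.ofReal_pow, ← ofReal_norm, Complex.norm_real,
    Real.norm_of_nonneg (by positivity)]

/-- Bernstein-type inequality for dilations of a fixed Schwartz Fourier multiplier. -/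
theorem exists_eLpNorm_le_of_fourier_eq_dilate_mul (M : 𝓢(V, ℂ)) {p q : ℝ≥0∞} (hp : 1 ≤ p)
    (hpq : p ≤ q) :
    ∃ D > (0 : ℝ), ∀ t > (0 : ℝ), ∀ f g : 𝓢(V, ℂ),
      (∀ ξ, 𝓕 (g : V → ℂ) ξ = M (t⁻¹ • ξ) * 𝓕 (f : V → ℂ) ξ) →
      eLpNorm g q volume ≤
        ENNReal.ofReal (D * t ^ ((Module.finrank ℝ V : ℝ) * (p⁻¹.toReal - q⁻¹.toReal))) *
          eLpNorm f p volume := by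
  set K : 𝓢(V, ℂ) := 𝓕⁻ M
  have hI : 0 ≤ ∫ z, ‖K z‖ := integral_nonneg fun _ ↦ norm_nonneg _
  obtain ⟨C, hC0, hC⟩ : ∃ C > 0, ∀ z, ‖K z‖ ≤ C := by
    obtain ⟨C, hC0, hC⟩ := K.decay 0 0
    exact ⟨C, hC0, fun z ↦ by simpa using hC z⟩
  refine ⟨(∫ z, ‖K z‖) + C, by positivity, fun t ht f g h ↦ ?_⟩
  set n := Module.finrank ℝ V
  have h_int : ∫⁻ z, ENNReal.ofReal (t ^ n) * ‖K (t • z)‖ₑ ≤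
      ENNReal.ofReal ((∫ z, ‖K z‖) + C) := by
    rw [lintegral_const_mul' _ _ ENNReal.ofReal_ne_top,
      ← ofReal_integral_norm_eq_lintegral_enorm (K.integrable.comp_smul ht.ne'),
      ← ENNReal.ofReal_mul (by positivity),
      Measure.integral_comp_smul_of_nonneg volume (fun z ↦ ‖K z‖) t (hR := ht.le), smul_eq_mul,
      mul_inv_cancel_left₀ (by positivity)]
    exact ENNReal.ofReal_le_ofReal (by linarith)
  have hsup (z : V) : ENNReal.ofReal (t ^ n) * ‖K (t • z)‖ₑ ≤
      ENNReal.ofReal (t ^ n) * ENNReal.ofReal ((∫ z, ‖K z‖) + C) := by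
    rw [← ofReal_norm]
    gcongr
    linarith [hC (t • z)]
  have hKm : Measurable fun z : V ↦ ENNReal.ofReal (t ^ n) * ‖K (t • z)‖ₑ :=
    ((K.continuous.comp (continuous_const_smul t)).measurable.enorm).const_mul _
  calc eLpNorm g q volume
      ≤ eLpNorm (fun x ↦ ∫⁻ y, ENNReal.ofReal (t ^ n) * ‖K (t • (x - y))‖ₑ * ‖f y‖ₑ) q volume :=
        eLpNorm_mono_enorm fun x ↦ enorm_le_lintegral_of_fourier_eq_dilate_mul M f g ht h x
    _ ≤ _ := eLpNorm_lintegral_kernel_le hKm f.continuous.measurable.enorm h_int hsup hp hpq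
    _ = _ := by
        rw [eLpNorm_enorm, ENNReal.ofReal_rpow_of_pos (by positivity),
          ← ENNReal.ofReal_mul (by positivity), ← Real.rpow_natCast_mul ht.le]

/-- Dilated Schwartz Fourier multipliers preserve Schwartz functions. -/
theorem exists_schwartz_fourier_eq_dilate_mul (M f : 𝓢(V, ℂ)) {t : ℝ} (ht : t ≠ 0) :
    ∃ g : 𝓢(V, ℂ), ∀ ξ, 𝓕 (g : V → ℂ) ξ = M (t⁻¹ • ξ) * 𝓕 (f : V → ℂ) ξ := by
  let e : V ≃L[ℝ] V := ContinuousLinearEquiv.smulLeft (Units.mk0 t⁻¹ (inv_ne_zero ht))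
  let N : 𝓢(V, ℂ) := SchwartzMap.compCLMOfContinuousLinearEquiv ℂ e M
  refine ⟨𝓕⁻ (SchwartzMap.smulLeftCLM ℂ N (𝓕 f)), fun ξ ↦ ?_⟩
  rw [← SchwartzMap.fourier_coe, FourierTransform.fourier_fourierInv_eq,
    SchwartzMap.smulLeftCLM_apply_apply N.hasTemperateGrowth, SchwartzMap.fourier_coe]
  rfl

end FourierMultiplier

/-- Bernstein inequalities, annulus case. -/
theorem bernstein_annulus (d : ℕ) (hd : 1 ≤ d) (α : ℝ) (hα : 0 ≤ α)
    (p q : ℝ≥0∞) (hp : 1 ≤ p) (hpq : p ≤ q) (K₁ K₂ : ℝ) (hK₁ : 0 < K₁) (hK₁₂ : K₁ ≤ K₂) :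
    ∃ C₁ > (0:ℝ), ∃ C₂ > (0:ℝ), ∀ j : ℤ, ∀ f : SchwartzMap (Rd d) ℂ,
      (Function.support (𝓕 ⇑f) ⊆ {ξ : Rd d | K₁ * 2 ^ j ≤ ‖ξ‖ ∧ ‖ξ‖ ≤ K₂ * 2 ^ j}) →
      ENNReal.ofReal (C₁ * 2 ^ (2 * (j : ℝ) * α)) * eLpNorm (⇑f) q volume ≤
          eLpNorm (LamC (2 * α) ⇑f) q volume ∧
        eLpNorm (LamC (2 * α) ⇑f) q volume ≤
          ENNReal.ofReal
              (C₂ * 2 ^ (2 * (j : ℝ) * α + (j : ℝ) * d * (p⁻¹.toReal - q⁻¹.toReal))) *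
            eLpNorm (⇑f) p volume := by
  obtain ⟨M, hM⟩ := exists_schwartz_eq_norm_rpow (V := Rd d) (2 * α) hK₁ hK₁₂
  obtain ⟨M', hM'⟩ := exists_schwartz_eq_norm_rpow (V := Rd d) (-(2 * α)) hK₁ hK₁₂
  obtain ⟨D, hD, hDM⟩ := exists_eLpNorm_le_of_fourier_eq_dilate_mul M hp hpq
  obtain ⟨D', hD', hDM'⟩ := exists_eLpNorm_le_of_fourier_eq_dilate_mul M' (hp.trans hpq) le_rfl
  refine ⟨D'⁻¹, inv_pos.2 hD', D, hD, fun j f hf ↦ ?_⟩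
  have ht : (0 : ℝ) < 2 ^ j := by positivity
  have htpow (s : ℝ) : ((2 : ℝ) ^ j) ^ s = 2 ^ ((j : ℝ) * s) := by
    rw [← Real.rpow_intCast, ← Real.rpow_mul zero_le_two]
  set t : ℝ := 2 ^ j
  have hmem {ξ : Rd d} (hξ : 𝓕 (f : Rd d → ℂ) ξ ≠ 0) :
      K₁ ≤ ‖t⁻¹ • ξ‖ ∧ ‖t⁻¹ • ξ‖ ≤ K₂ := by
    obtain ⟨h1, h2⟩ := hf hξ
    rw [norm_smul, norm_inv, Real.norm_of_nonneg ht.le, inv_mul_eq_div, le_div_iff₀ ht,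
      div_le_iff₀ ht]
    exact ⟨h1, h2⟩
  obtain ⟨g, hg⟩ := exists_schwartz_fourier_eq_dilate_mul M f ht.ne'
  have hfg (ξ : Rd d) : 𝓕 (f : Rd d → ℂ) ξ = M' (t⁻¹ • ξ) * 𝓕 (g : Rd d → ℂ) ξ := by
    by_cases hξ : 𝓕 (f : Rd d → ℂ) ξ = 0
    · simp [hg, hξ]
    obtain ⟨h1, h2⟩ := hmem hξ
    rw [hg, hM _ h1 h2, hM' _ h1 h2, ← mul_assoc, ← Complex.ofReal_mul,
      ← Real.rpow_add (hK₁.trans_le h1), neg_add_cancel, Real.rpow_zero, Complex.ofReal_one,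
      one_mul]
  have hLam : LamC (2 * α) f = (t ^ (2 * α)) • (g : Rd d → ℂ) := by
    have : (fun ξ : Rd d ↦ (‖ξ‖ ^ (2 * α) : ℝ) • 𝓕 (f : Rd d → ℂ) ξ) =
        ⇑(((t ^ (2 * α) : ℝ) : ℂ) • (𝓕 g : SchwartzMap (Rd d) ℂ) : SchwartzMap (Rd d) ℂ) := by
      ext ξ
      change _ = ((t ^ (2 * α) : ℝ) : ℂ) * (𝓕 g : SchwartzMap (Rd d) ℂ) ξ
      rw [SchwartzMap.fourier_coe, hg]
      by_cases hξ : 𝓕 (f : Rd d → ℂ) ξ = 0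
      · simp [hξ]
      obtain ⟨h1, h2⟩ := hmem hξ
      rw [hM _ h1 h2, norm_smul, norm_inv, Real.norm_of_nonneg ht.le, ← mul_assoc,
        ← Complex.ofReal_mul, ← Real.mul_rpow ht.le (by positivity), mul_inv_cancel_left₀ ht.ne']
      rfl
    rw [LamC, this, ← SchwartzMap.fourierInv_coe, FourierTransform.fourierInv_smul,
      FourierTransform.fourierInv_fourier_eq]
    ext x
    simp
  have hnorm : eLpNorm (LamC (2 * α) f) q volume =
      ENNReal.ofReal (2 ^ (2 * (j : ℝ) * α)) * eLpNorm g q volume := by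
    rw [hLam, eLpNorm_const_smul, Real.enorm_of_nonneg (by positivity), htpow]
    ring_nf
  rw [hnorm]
  constructor
  · have h := hDM' t ht g f hfg
    rw [sub_self, mul_zero, Real.rpow_zero, mul_one] at h
    calc _ ≤ ENNReal.ofReal (D'⁻¹ * 2 ^ (2 * (j : ℝ) * α)) *
          (ENNReal.ofReal D' * eLpNorm g q volume) := by gcongr
      _ = _ := by
          rw [← mul_assoc, ← ENNReal.ofReal_mul (by positivity), mul_right_comm,
            inv_mul_cancel₀ hD'.ne', one_mul]
  · refine (mul_le_mul_right (hDM t ht f g hg) _).trans_eq ?_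
    rw [← mul_assoc, ← ENNReal.ofReal_mul (by positivity), finrank_euclideanSpace_fin,
      htpow, mul_left_comm, ← Real.rpow_add two_pos, ← mul_assoc (j : ℝ)]
end
end

section
/- Let d ≥ 1 and σ > d/2 − 1. Let χ, φ : ℝ^d → [0,1] be smooth functions with supp χ ⊆ {|ξ| ≤ 4/3}, supp φ ⊆ {3/4 ≤ |ξ| ≤ 8/3}, and χ(ξ) + Σ_{j≥0} φ(2^{−j}ξ) = 1 for all ξ ∈ ℝ^d. For Schwartz f define the nonhomogeneous Littlewood–Paley blocks Δ_{−1} f := 𝓕^{-1}(χ · 𝓕f) and, for j ≥ 0, Δ_j f := 𝓕^{-1}(φ(2^{−j}·) 𝓕f). Then there exists a constant C > 0 (depending on σ, d, χ, φ) such that for every Schwartz vector field u : ℝ^d → ℝ^d and every Schwartz f : ℝ^d → ℝ there exists a sequence (c_j)_{j≥−1} of nonnegative reals with Σ_{j≥−1} c_j² = 1 and, for every j ≥ −1, ‖u·∇(Δ_j f) − Δ_j(u·∇f)‖_{L²(ℝ^d)} ≤ C c_j 2^{−j(σ+1)} ‖∇u‖_{H^{σ+1}} ‖f‖_{H^{σ+1}}.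 -/
open MeasureTheory Real Set
open scoped FourierTransform ENNReal

noncomputable section

/-- i-th partial derivative (real-valued functions). -/
def pd {d : ℕ} (i : Fin d) (f : Rd d → ℝ) : Rd d → ℝ :=
  fun x => fderiv ℝ f x (EuclideanSpace.single i 1)

/-- i-th partial derivative (complex-valued functions). -/
def pdC {d : ℕ} (i : Fin d) (f : Rd d → ℂ) : Rd d → ℂ :=
  fun x => fderiv ℝ f x (EuclideanSpace.single i 1)

/-- Complexification of a real-valued function. -/
def cplx {d : ℕ} (f : Rd d → ℝ) : Rd d → ℂ := fun x => (f x : ℂ)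

/-- Nonhomogeneous Littlewood–Paley block Δ_j (for j ≥ -1) built from the
cutoffs χ and φ. -/
def LPblock {d : ℕ} (χ φ : Rd d → ℝ) (j : ℤ) (f : Rd d → ℂ) : Rd d → ℂ :=
  if j = -1 then 𝓕⁻ (fun ξ : Rd d => (χ ξ : ℂ) * 𝓕 f ξ)
  else if 0 ≤ j then 𝓕⁻ (fun ξ : Rd d => (φ ((2 : ℝ) ^ (-j) • ξ) : ℂ) * 𝓕 f ξ)
  else 0

theorem lintegral_mul_sq_le {α : Type*} [MeasurableSpace α] (μ : Measure α) {f g : α → ℝ≥0∞}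
    (hf : AEMeasurable f μ) (hg : AEMeasurable g μ) :
    (∫⁻ a, f a * g a ∂μ) ^ 2 ≤ (∫⁻ a, f a ^ 2 ∂μ) * ∫⁻ a, g a ^ 2 ∂μ := by
  have h := ENNReal.lintegral_mul_le_Lp_mul_Lq μ Real.HolderConjugate.two_two hf hg
  simp only [Pi.mul_apply, ENNReal.rpow_two] at h
  calc _ ≤ ((∫⁻ a, f a ^ 2 ∂μ) ^ (1 / 2 : ℝ) * (∫⁻ a, g a ^ 2 ∂μ) ^ (1 / 2 : ℝ)) ^ 2 := by gcongr
    _ = _ := by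
      rw [mul_pow, ← ENNReal.rpow_mul_natCast, ← ENNReal.rpow_mul_natCast]
      norm_num

theorem exists_hasSum_sq_one {ι : Type*} [DecidableEq ι] (i₀ : ι) (a : ι → ℝ≥0∞) {K : ℝ≥0∞}
    (hK : K ≠ ∞) (h : ∑' i, a i ^ 2 ≤ K ^ 2) :
    ∃ c : ι → ℝ, (∀ i, 0 ≤ c i) ∧ HasSum (fun i => c i ^ 2) 1 ∧
      ∀ i, a i ≤ ENNReal.ofReal (c i) * K := by
  set S := ∑' i, a i ^ 2 with hS
  have hStop : S ≠ ∞ := ne_top_of_le_ne_top (by finiteness) h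
  by_cases hS0 : S = 0
  · refine ⟨Pi.single i₀ 1, fun i => ?_, ?_, fun i => ?_⟩
    · by_cases hi : i = i₀
      · subst hi; simp
      · simp [hi]
    · convert hasSum_single (f := fun i => (Pi.single i₀ (1 : ℝ) : ι → ℝ) i ^ 2) i₀ ?_ using 1
      · simp
      · intro i hi; simp [hi]
    · have h0 : a i = 0 := by simpa using ENNReal.tsum_eq_zero.1 hS0 i
      simp [h0]
  · have hSpos : 0 < S.toReal := ENNReal.toReal_pos hS0 hStop
    have hsum : HasSum (fun i => (a i ^ 2).toReal) S.toReal := by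
      rw [hS, ENNReal.tsum_toReal_eq (fun i => ENNReal.ne_top_of_tsum_ne_top hStop i)]
      exact ENNReal.hasSum_toReal hStop
    have hatop : ∀ i, a i ≠ ∞ := fun i hi => by
      have := ENNReal.ne_top_of_tsum_ne_top hStop i
      simp [hi] at this
    refine ⟨fun i => (a i).toReal / √S.toReal, fun i => by positivity, ?_, fun i => ?_⟩
    · rw [← div_self hSpos.ne']
      simpa only [ENNReal.toReal_pow, div_pow, Real.sq_sqrt hSpos.le] using
        hsum.div_const S.toReal
    · have hSK : √S.toReal ≤ K.toReal := by
        apply Real.sqrt_le_iff.2 ⟨by positivity, ?_⟩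
        rw [← ENNReal.toReal_pow]
        exact ENNReal.toReal_mono (by finiteness) h
      have hsq : 0 < √S.toReal := Real.sqrt_pos.2 hSpos
      rw [← ENNReal.ofReal_toReal hK, ← ENNReal.ofReal_mul (by positivity),
        ← ENNReal.ofReal_toReal (hatop i)]
      apply ENNReal.ofReal_le_ofReal
      rw [div_mul_eq_mul_div, le_div_iff₀ hsq]
      gcongr

section Young

variable {G : Type*} [AddCommGroup G] [MeasurableSpace G] [MeasurableAdd₂ G] [MeasurableNeg G]
  (μ : Measure G) [SFinite μ] [μ.IsAddLeftInvariant] [μ.IsNegInvariant]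

theorem lintegral_sq_convolution_le {f g : G → ℝ≥0∞} (hf : Measurable f) (hg : Measurable g) :
    ∫⁻ x, (∫⁻ y, f (x - y) * g y ∂μ) ^ 2 ∂μ ≤ (∫⁻ x, f x ∂μ) ^ 2 * ∫⁻ x, g x ^ 2 ∂μ := by
  have hsub : Measurable fun p : G × G => f (p.1 - p.2) := by
    simp_rw [sub_eq_add_neg]; fun_prop
  have hsub' : ∀ x, Measurable fun y => f (x - y) := fun x => by
    simp_rw [sub_eq_add_neg]; fun_prop
  have key : ∀ x, (∫⁻ y, f (x - y) * g y ∂μ) ^ 2 ≤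
      (∫⁻ x, f x ∂μ) * ∫⁻ y, f (x - y) * g y ^ 2 ∂μ := fun x => by
    have h := lintegral_mul_sq_le μ (f := fun y => f (x - y) ^ (1 / 2 : ℝ))
      (g := fun y => f (x - y) ^ (1 / 2 : ℝ) * g y)
      ((hsub' x).pow_const _).aemeasurable (((hsub' x).pow_const _).mul hg).aemeasurable
    have e : ∀ z : ℝ≥0∞, z ^ (1 / 2 : ℝ) * z ^ (1 / 2 : ℝ) = z := fun z => by
      rw [← ENNReal.rpow_add_of_nonneg _ _ (by norm_num) (by norm_num)]; norm_num
    have e' : ∀ z : ℝ≥0∞, (z ^ (1 / 2 : ℝ)) ^ 2 = z := fun z => by rw [sq, e]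
    simp only [mul_pow, ← mul_assoc, e, e'] at h
    rwa [lintegral_sub_left_eq_self (fun y => f y) x] at h
  calc _ ≤ ∫⁻ x, (∫⁻ x, f x ∂μ) * ∫⁻ y, f (x - y) * g y ^ 2 ∂μ ∂μ := lintegral_mono key
    _ = (∫⁻ x, f x ∂μ) * ∫⁻ x, ∫⁻ y, f (x - y) * g y ^ 2 ∂μ ∂μ :=
      lintegral_const_mul _ (Measurable.lintegral_prod_right' (f := fun p : G × G =>
        f (p.1 - p.2) * g p.2 ^ 2) (by fun_prop))
    _ = (∫⁻ x, f x ∂μ) * ∫⁻ y, ∫⁻ x, f (x - y) * g y ^ 2 ∂μ ∂μ := by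
      rw [lintegral_lintegral_swap]
      exact (by fun_prop : Measurable fun p : G × G => f (p.1 - p.2) * g p.2 ^ 2).aemeasurable
    _ = (∫⁻ x, f x ∂μ) * ∫⁻ y, (∫⁻ x, f x ∂μ) * g y ^ 2 ∂μ := by
      congr 1
      refine lintegral_congr fun y => ?_
      rw [lintegral_mul_const _ (by simp_rw [sub_eq_add_neg]; fun_prop),
        lintegral_sub_right_eq_self (fun x => f x) y]
    _ = _ := by rw [lintegral_const_mul _ (by fun_prop)]; ring

theorem lintegral_sq_convolution_le' {f g : G → ℝ≥0∞} (hf : Measurable f) (hg : Measurable g) :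
    ∫⁻ x, (∫⁻ y, f (x - y) * g y ∂μ) ^ 2 ∂μ ≤ (∫⁻ x, f x ^ 2 ∂μ) * (∫⁻ x, g x ∂μ) ^ 2 := by
  rw [mul_comm]
  convert lintegral_sq_convolution_le μ hg hf using 4 with x
  rw [← lintegral_sub_left_eq_self _ x]
  simp [mul_comm]

end Young

/-- The Bessel weight `⟨ξ⟩ ^ s`. -/
def besselWeight {d : ℕ} (s : ℝ) (ξ : Rd d) : ℝ := (1 + ‖ξ‖ ^ 2) ^ (s / 2)

theorem besselWeight_pos {d : ℕ} (s : ℝ) (ξ : Rd d) : 0 < besselWeight s ξ := by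
  unfold besselWeight; positivity

theorem besselWeight_sq {d : ℕ} (s : ℝ) (ξ : Rd d) :
    besselWeight s ξ ^ 2 = (1 + ‖ξ‖ ^ 2) ^ s := by
  rw [besselWeight, ← Real.rpow_mul_natCast (by positivity)]
  norm_num

@[fun_prop]
theorem measurable_besselWeight {d : ℕ} (s : ℝ) :
    Measurable (besselWeight s : Rd d → ℝ) := by
  unfold besselWeight; fun_prop

theorem besselWeight_eq {d : ℕ} (s : ℝ) (ξ : Rd d) :
    besselWeight s ξ = √(1 + ‖ξ‖ ^ 2) ^ s := by
  rw [besselWeight, Real.sqrt_eq_rpow, ← Real.rpow_mul (by positivity)]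
  ring_nf

theorem besselWeight_le {d : ℕ} {s : ℝ} (hs : 0 ≤ s) (ξ η : Rd d) :
    besselWeight s ξ ≤ 2 ^ s * (besselWeight s (ξ - η) + besselWeight s η) := by
  have htri : ‖ξ‖ ≤ ‖ξ - η‖ + ‖η‖ := by simpa using norm_add_le (ξ - η) η
  have key : ∀ r : ℝ, 0 ≤ r → ‖ξ‖ ≤ 2 * r →
      besselWeight s ξ ≤ 2 ^ s * (1 + r ^ 2) ^ (s / 2) := fun r hr h => by
    have e : (2 : ℝ) ^ s = 4 ^ (s / 2) := by
      rw [show (4 : ℝ) = 2 ^ (2 : ℝ) by norm_num, ← Real.rpow_mul (by norm_num)]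
      ring_nf
    rw [e, ← Real.mul_rpow (by norm_num) (by positivity), besselWeight]
    exact Real.rpow_le_rpow (by positivity) (by nlinarith [norm_nonneg ξ]) (by linarith)
  have h1 := besselWeight_pos s (ξ - η)
  have h2 := besselWeight_pos s η
  have h3 : (0 : ℝ) < 2 ^ s := by positivity
  rcases le_total ‖ξ - η‖ ‖η‖ with h | h
  · refine (key ‖η‖ (norm_nonneg _) (by linarith)).trans ?_
    change 2 ^ s * besselWeight s η ≤ _
    gcongr; linarith
  · refine (key ‖ξ - η‖ (norm_nonneg _) (by linarith)).trans ?_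
    change 2 ^ s * besselWeight s (ξ - η) ≤ _
    gcongr; linarith

theorem lintegral_besselWeight_neg_lt_top {d : ℕ} {s : ℝ} (hs : (d : ℝ) / 2 < s) :
    ∫⁻ ξ : Rd d, ENNReal.ofReal (besselWeight (-s) ξ) ^ 2 < ∞ := by
  have h : Integrable (fun ξ : Rd d => (1 + ‖ξ‖ ^ 2) ^ (-(2 * s) / 2)) :=
    integrable_rpow_neg_one_add_norm_sq (by simp; linarith)
  convert h.lintegral_lt_top using 3 with ξ
  rw [← ENNReal.ofReal_pow (besselWeight_pos _ _).le, besselWeight_sq]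
  ring_nf

theorem sq_lintegral_le_lintegral_besselWeight {d : ℕ} (s : ℝ) {f : Rd d → ℝ≥0∞}
    (hf : Measurable f) :
    (∫⁻ ξ, f ξ) ^ 2 ≤ (∫⁻ ξ : Rd d, ENNReal.ofReal (besselWeight (-s) ξ) ^ 2) *
      ∫⁻ ξ, (ENNReal.ofReal (besselWeight s ξ) * f ξ) ^ 2 := by
  convert lintegral_mul_sq_le (volume : Measure (Rd d))
    (f := fun ξ => ENNReal.ofReal (besselWeight (-s) ξ))
    (g := fun ξ => ENNReal.ofReal (besselWeight s ξ) * f ξ) (by fun_prop) (by fun_prop) using 4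
    with ξ
  rw [← mul_assoc, ← ENNReal.ofReal_mul (besselWeight_pos _ _).le, besselWeight, besselWeight,
    ← Real.rpow_add (by positivity)]
  simp [neg_div]

/-- The frequencies `ξ` with `⟨ξ⟩` comparable to `2 ^ j`. -/
def dyadicShell (d : ℕ) (j : ℤ) : Set (Rd d) :=
  {ξ | (2 : ℝ) ^ j ≤ 2 * √(1 + ‖ξ‖ ^ 2) ∧ √(1 + ‖ξ‖ ^ 2) ≤ 5 * 2 ^ j}

theorem measurableSet_dyadicShell (d : ℕ) (j : ℤ) : MeasurableSet (dyadicShell d j) :=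
  (measurableSet_le (g := fun ξ : Rd d => 2 * √(1 + ‖ξ‖ ^ 2)) (by fun_prop) (by fun_prop)).inter
    (measurableSet_le (f := fun ξ : Rd d => √(1 + ‖ξ‖ ^ 2)) (by fun_prop) (by fun_prop))

theorem tsum_indicator_dyadicShell_le {d : ℕ} (ξ : Rd d) :
    ∑' j : ℤ, (dyadicShell d j).indicator (1 : Rd d → ℝ≥0∞) ξ ≤ 4 := by
  have hpos : 0 < 2 * √(1 + ‖ξ‖ ^ 2) := by positivity
  obtain ⟨n, hn, hn'⟩ := exists_mem_Ico_zpow hpos (one_lt_two : (1 : ℝ) < 2)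
  have hsub : ∀ j ∉ Finset.Icc (n - 3) n,
      (dyadicShell d j).indicator (1 : Rd d → ℝ≥0∞) ξ = 0 := fun j hj => by
    refine indicator_of_notMem (fun hmem => hj ?_) _
    obtain ⟨h1, h2⟩ := hmem
    rw [Finset.mem_Icc]
    have a1 : j < n + 1 := (zpow_lt_zpow_iff_right₀ one_lt_two).1 (h1.trans_lt hn')
    have a2 : n < j + 4 := by
      refine (zpow_lt_zpow_iff_right₀ (one_lt_two : (1 : ℝ) < 2)).1 (hn.trans_lt ?_)
      have : (0 : ℝ) < 2 ^ j := by positivity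
      rw [zpow_add₀ two_ne_zero]
      norm_num
      linarith
    constructor <;> linarith
  rw [tsum_eq_sum hsub]
  calc _ ≤ ∑ j ∈ Finset.Icc (n - 3) n, (1 : ℝ≥0∞) :=
        Finset.sum_le_sum fun j _ => indicator_le_self' (by simp) ξ
    _ ≤ 4 := by simp

theorem tsum_lintegral_indicator_dyadicShell_le {d : ℕ} {f : Rd d → ℝ≥0∞} (hf : Measurable f) :
    ∑' j : ℤ, ∫⁻ ξ, (dyadicShell d j).indicator 1 ξ * f ξ ≤ 4 * ∫⁻ ξ, f ξ := by
  have hm : ∀ j, Measurable ((dyadicShell d j).indicator (1 : Rd d → ℝ≥0∞)) := fun j =>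
    measurable_one.indicator (measurableSet_dyadicShell d j)
  rw [← lintegral_tsum (f := fun j ξ => (dyadicShell d j).indicator 1 ξ * f ξ)
    fun j => ((hm j).mul hf).aemeasurable, ← lintegral_const_mul _ hf]
  refine lintegral_mono fun ξ => ?_
  dsimp only
  rw [ENNReal.tsum_mul_right]
  gcongr
  exact tsum_indicator_dyadicShell_le ξ

theorem measurable_indicator_dyadicShell {d : ℕ} (j : ℤ) :
    Measurable ((dyadicShell d j).indicator (1 : Rd d → ℝ≥0∞)) :=
  measurable_one.indicator (measurableSet_dyadicShell d j)

theorem indicator_one_sq {α : Type*} (s : Set α) (a : α) :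
    s.indicator (1 : α → ℝ≥0∞) a ^ 2 = s.indicator 1 a := by
  by_cases h : a ∈ s <;> simp [h]

theorem sum_sq_le_card_mul {ι : Type*} [Fintype ι] (f : ι → ℝ≥0∞) :
    (∑ i, f i) ^ 2 ≤ Fintype.card ι * ∑ i, f i ^ 2 := by
  let : MeasurableSpace ι := ⊤
  simpa [lintegral_count, tsum_fintype] using lintegral_mul_sq_le Measure.count
    (f := fun _ => 1) (g := f) (by fun_prop) (measurable_from_top).aemeasurable

theorem add_add_sq_le (a b c : ℝ≥0∞) : (a + b + c) ^ 2 ≤ 3 * (a ^ 2 + b ^ 2 + c ^ 2) := by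
  simpa [Fin.sum_univ_three] using sum_sq_le_card_mul ![a, b, c]

/-- The sum over dyadic shells of the paraproduct-type convolutions which control the
Littlewood–Paley commutators. -/
theorem tsum_lintegral_sq_shell_convolution_le {d : ℕ} (s : ℝ) {B F : Rd d → ℝ≥0∞}
    (hB : Measurable B) (hF : Measurable F) :
    ∑' j : ℤ, ∫⁻ ξ, (∫⁻ η, B (ξ - η) *
      ((dyadicShell d j).indicator 1 η * ENNReal.ofReal (besselWeight s η) +
        (dyadicShell d j).indicator 1 ξ * (ENNReal.ofReal (besselWeight s (ξ - η)) +
          ENNReal.ofReal (besselWeight s η))) * F η) ^ 2 ≤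
      36 * (∫⁻ ξ : Rd d, ENNReal.ofReal (besselWeight (-s) ξ) ^ 2) *
        (∫⁻ ξ, (ENNReal.ofReal (besselWeight s ξ) * B ξ) ^ 2) *
        ∫⁻ ξ, (ENNReal.ofReal (besselWeight s ξ) * F ξ) ^ 2 := by
  set w : Rd d → ℝ≥0∞ := fun ξ => ENNReal.ofReal (besselWeight s ξ) with hw
  have hwm : Measurable w := by fun_prop
  set I : ℤ → Rd d → ℝ≥0∞ := fun j => (dyadicShell d j).indicator 1 with hI
  have hIm : ∀ j, Measurable (I j) := measurable_indicator_dyadicShell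
  set A := ∫⁻ ξ : Rd d, ENNReal.ofReal (besselWeight (-s) ξ) ^ 2
  set b := ∫⁻ ξ, (w ξ * B ξ) ^ 2
  set g := ∫⁻ ξ, (w ξ * F ξ) ^ 2
  have hB1 : (∫⁻ ξ, B ξ) ^ 2 ≤ A * b := sq_lintegral_le_lintegral_besselWeight s hB
  have hF1 : (∫⁻ ξ, F ξ) ^ 2 ≤ A * g := sq_lintegral_le_lintegral_besselWeight s hF
  set X : ℤ → Rd d → ℝ≥0∞ := fun j ξ => ∫⁻ η, B (ξ - η) * (I j η * (w η * F η))
  set Y : Rd d → ℝ≥0∞ := fun ξ => ∫⁻ η, (w (ξ - η) * B (ξ - η)) * F η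
  set Z : Rd d → ℝ≥0∞ := fun ξ => ∫⁻ η, B (ξ - η) * (w η * F η)
  have hXm : ∀ j, Measurable (X j) := fun j => by
    refine Measurable.lintegral_prod_right' (f := fun p : Rd d × Rd d =>
      B (p.1 - p.2) * (I j p.2 * (w p.2 * F p.2))) ?_
    have := hIm j
    fun_prop
  have hYm : Measurable Y := Measurable.lintegral_prod_right' (f := fun p : Rd d × Rd d =>
      (w (p.1 - p.2) * B (p.1 - p.2)) * F p.2) (by fun_prop)
  have hZm : Measurable Z := Measurable.lintegral_prod_right' (f := fun p : Rd d × Rd d =>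
      B (p.1 - p.2) * (w p.2 * F p.2)) (by fun_prop)
  have hX : ∑' j, ∫⁻ ξ, X j ξ ^ 2 ≤ 4 * (A * b * g) := calc
    _ ≤ ∑' j, (A * b) * ∫⁻ ξ, I j ξ * (w ξ * F ξ) ^ 2 := by
      refine ENNReal.tsum_le_tsum fun j => ?_
      have := hIm j
      refine (lintegral_sq_convolution_le volume hB (by fun_prop)).trans ?_
      refine mul_le_mul' hB1 (le_of_eq (lintegral_congr fun ξ => ?_))
      rw [mul_pow, indicator_one_sq]
    _ ≤ (A * b) * (4 * g) := by
      rw [ENNReal.tsum_mul_left]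
      exact mul_le_mul_right (tsum_lintegral_indicator_dyadicShell_le (by fun_prop)) _
    _ = _ := by ring
  have hY : ∫⁻ ξ, Y ξ ^ 2 ≤ A * b * g :=
    (lintegral_sq_convolution_le' volume (f := fun ξ => w ξ * B ξ) (by fun_prop) hF).trans
      ((mul_le_mul_right hF1 _).trans_eq (by ring))
  have hZ : ∫⁻ ξ, Z ξ ^ 2 ≤ A * b * g :=
    (lintegral_sq_convolution_le volume hB (by fun_prop)).trans (mul_le_mul_left hB1 _)
  have hsplit : ∀ j ξ, (∫⁻ η, B (ξ - η) * (I j η * w η + I j ξ * (w (ξ - η) + w η)) * F η) =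
      X j ξ + I j ξ * Y ξ + I j ξ * Z ξ := fun j ξ => by
    have := hIm j
    have hsub : Measurable fun η => ξ - η := by fun_prop
    rw [← lintegral_const_mul _ (by fun_prop), ← lintegral_const_mul _ (by fun_prop),
      ← lintegral_add_left (by fun_prop), ← lintegral_add_left (by fun_prop)]
    exact lintegral_congr fun η => by ring
  calc _ ≤ ∑' j, 3 * ((∫⁻ ξ, X j ξ ^ 2) + (∫⁻ ξ, I j ξ * Y ξ ^ 2) + ∫⁻ ξ, I j ξ * Z ξ ^ 2) := by
        refine ENNReal.tsum_le_tsum fun j => ?_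
        have := hIm j
        have := hXm j
        rw [← lintegral_add_left (by fun_prop), ← lintegral_add_left (by fun_prop),
          ← lintegral_const_mul _ (by fun_prop)]
        refine lintegral_mono fun ξ => ?_
        dsimp only
        rw [hsplit]
        refine (add_add_sq_le _ _ _).trans_eq ?_
        rw [mul_pow, mul_pow, indicator_one_sq]
    _ ≤ 3 * (4 * (A * b * g) + 4 * (A * b * g) + 4 * (A * b * g)) := by
        rw [ENNReal.tsum_mul_left, ENNReal.tsum_add, ENNReal.tsum_add]
        gcongr
        · exact (tsum_lintegral_indicator_dyadicShell_le (by fun_prop)).trans (by gcongr)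
        · exact (tsum_lintegral_indicator_dyadicShell_le (by fun_prop)).trans (by gcongr)
    _ = _ := by ring

/-- The Fourier multiplier of the Littlewood–Paley block of index `j ≥ -1`. -/
def LPsymbol {d : ℕ} (χ φ : Rd d → ℝ) (j : ℤ) (ξ : Rd d) : ℝ :=
  if j = -1 then χ ξ else φ ((2 : ℝ) ^ (-j) • ξ)

section Symbol

variable {d : ℕ} {χ φ : Rd d → ℝ}

theorem LPsymbol_mem_Icc (hχ : ∀ ξ, χ ξ ∈ Icc (0 : ℝ) 1) (hφ : ∀ ξ, φ ξ ∈ Icc (0 : ℝ) 1)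
    (j : ℤ) (ξ : Rd d) : LPsymbol χ φ j ξ ∈ Icc (0 : ℝ) 1 := by
  unfold LPsymbol; split_ifs <;> simp only [hχ, hφ]

theorem LPsymbol_contDiff (hχ : ContDiff ℝ (⊤ : ℕ∞) χ) (hφ : ContDiff ℝ (⊤ : ℕ∞) φ) (j : ℤ) :
    ContDiff ℝ (⊤ : ℕ∞) (LPsymbol χ φ j) := by
  unfold LPsymbol
  split_ifs
  · exact hχ
  · exact hφ.comp (contDiff_const_smul _)

theorem mem_dyadicShell_of_LPsymbol_ne_zero
    (hχ : Function.support χ ⊆ {ξ : Rd d | ‖ξ‖ ≤ 4/3})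
    (hφ : Function.support φ ⊆ {ξ : Rd d | 3/4 ≤ ‖ξ‖ ∧ ‖ξ‖ ≤ 8/3})
    {j : ℤ} (hj : -1 ≤ j) {ξ : Rd d} (h : LPsymbol χ φ j ξ ≠ 0) : ξ ∈ dyadicShell d j := by
  have h1 : √(1 + ‖ξ‖ ^ 2) ≤ 1 + ‖ξ‖ :=
    Real.sqrt_le_iff.2 ⟨by positivity, by nlinarith [norm_nonneg ξ]⟩
  have h2 : 1 ≤ √(1 + ‖ξ‖ ^ 2) := Real.one_le_sqrt.2 (by nlinarith [norm_nonneg ξ])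
  have h3 : ‖ξ‖ ≤ √(1 + ‖ξ‖ ^ 2) := Real.le_sqrt_of_sq_le (by linarith)
  by_cases hj1 : j = -1
  · subst hj1
    have h4 : ‖ξ‖ ≤ 4 / 3 := hχ (by simpa [LPsymbol] using h)
    constructor <;> norm_num <;> linarith
  · have h5 : (1 : ℝ) ≤ 2 ^ j := one_le_zpow₀ one_le_two (by omega)
    have h4 := hφ (a := (2 : ℝ) ^ (-j) • ξ) (by simpa [LPsymbol, hj1] using h)
    rw [Set.mem_ofPred_eq, norm_smul, Real.norm_of_nonneg (by positivity), zpow_neg,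
      inv_mul_eq_div, le_div_iff₀ (by positivity), div_le_iff₀ (by positivity)] at h4
    constructor <;> linarith

theorem hasCompactSupport_LPsymbol
    (hχ : Function.support χ ⊆ {ξ : Rd d | ‖ξ‖ ≤ 4/3})
    (hφ : Function.support φ ⊆ {ξ : Rd d | 3/4 ≤ ‖ξ‖ ∧ ‖ξ‖ ≤ 8/3})
    {j : ℤ} (hj : -1 ≤ j) : HasCompactSupport (LPsymbol χ φ j) := by
  refine HasCompactSupport.of_support_subset_isCompact
    (isCompact_closedBall (0 : Rd d) (5 * 2 ^ j)) fun ξ hξ => ?_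
  have h := (mem_dyadicShell_of_LPsymbol_ne_zero hχ hφ hj hξ).2
  rw [mem_closedBall_zero_iff]
  exact (Real.le_sqrt_of_sq_le (by linarith)).trans h

theorem exists_abs_LPsymbol_sub_le
    (hχsm : ContDiff ℝ (⊤ : ℕ∞) χ) (hφsm : ContDiff ℝ (⊤ : ℕ∞) φ)
    (hχ : Function.support χ ⊆ {ξ : Rd d | ‖ξ‖ ≤ 4/3})
    (hφ : Function.support φ ⊆ {ξ : Rd d | 3/4 ≤ ‖ξ‖ ∧ ‖ξ‖ ≤ 8/3}) :
    ∃ L : ℝ, 0 ≤ L ∧ ∀ j : ℤ, -1 ≤ j → ∀ ξ η : Rd d,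
      |LPsymbol χ φ j η - LPsymbol χ φ j ξ| * 2 ^ j ≤ L * ‖ξ - η‖ := by
  have hχc : HasCompactSupport χ := HasCompactSupport.of_support_subset_isCompact
    (isCompact_closedBall (0 : Rd d) (4 / 3)) fun ξ hξ => by simpa using hχ hξ
  have hφc : HasCompactSupport φ := HasCompactSupport.of_support_subset_isCompact
    (isCompact_closedBall (0 : Rd d) (8 / 3)) fun ξ hξ => by simpa using (hφ hξ).2
  obtain ⟨K, hK⟩ := hχsm.lipschitzWith_of_hasCompactSupport hχc (by simp)
  obtain ⟨M, hM⟩ := hφsm.lipschitzWith_of_hasCompactSupport hφc (by simp)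
  refine ⟨K + M, by positivity, fun j hj ξ η => ?_⟩
  have hKM : (K : ℝ) * ‖ξ - η‖ ≤ (K + M) * ‖ξ - η‖ ∧ (M : ℝ) * ‖ξ - η‖ ≤ (K + M) * ‖ξ - η‖ := by
    constructor <;> gcongr <;> simp
  unfold LPsymbol
  split_ifs with h
  · have := hK.dist_le_mul η ξ
    rw [Real.dist_eq, dist_comm, dist_eq_norm] at this
    subst h
    have h0 := abs_nonneg (χ η - χ ξ)
    norm_num
    linarith
  · have := hM.dist_le_mul ((2 : ℝ) ^ (-j) • η) ((2 : ℝ) ^ (-j) • ξ)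
    rw [Real.dist_eq, dist_comm, dist_eq_norm, ← smul_sub, norm_smul,
      Real.norm_of_nonneg (by positivity), zpow_neg, inv_mul_eq_div, ← mul_div_assoc,
      le_div_iff₀ (by positivity)] at this
    rw [zpow_neg]
    exact this.trans hKM.2

theorem exists_commutator_kernel_le {s : ℝ} (hs : 0 ≤ s)
    (hχsm : ContDiff ℝ (⊤ : ℕ∞) χ) (hφsm : ContDiff ℝ (⊤ : ℕ∞) φ)
    (hχ01 : ∀ ξ, χ ξ ∈ Icc (0 : ℝ) 1) (hφ01 : ∀ ξ, φ ξ ∈ Icc (0 : ℝ) 1)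
    (hχ : Function.support χ ⊆ {ξ : Rd d | ‖ξ‖ ≤ 4/3})
    (hφ : Function.support φ ⊆ {ξ : Rd d | 3/4 ≤ ‖ξ‖ ∧ ‖ξ‖ ≤ 8/3}) :
    ∃ C : ℝ, 0 < C ∧ ∀ j : ℤ, -1 ≤ j → ∀ ξ η : Rd d,
      2 ^ (j * s) * (‖η‖ * |LPsymbol χ φ j η - LPsymbol χ φ j ξ|) ≤
        C * (‖ξ - η‖ * ((dyadicShell d j).indicator 1 η * besselWeight s η +
          (dyadicShell d j).indicator 1 ξ * (besselWeight s (ξ - η) + besselWeight s η))) := by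
  obtain ⟨L, hL0, hL⟩ := exists_abs_LPsymbol_sub_le hχsm hφsm hχ hφ
  have h2s : (1 : ℝ) ≤ 2 ^ s := Real.one_le_rpow one_le_two hs
  refine ⟨(5 * L + 1) * (2 ^ s * 2 ^ s), by positivity, fun j hj ξ η => ?_⟩
  have hw1 := besselWeight_pos s (ξ - η)
  have hw2 := besselWeight_pos s η
  have hshell : ∀ ζ ∈ dyadicShell d j, (2 : ℝ) ^ (j * s) ≤ 2 ^ s * besselWeight s ζ ∧
      ‖ζ‖ ≤ 5 * 2 ^ j := fun ζ hζ => by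
    refine ⟨?_, (Real.le_sqrt_of_sq_le (by linarith)).trans hζ.2⟩
    rw [besselWeight_eq, ← Real.mul_rpow (by norm_num) (by positivity), Real.rpow_mul (by norm_num),
      Real.rpow_intCast]
    exact Real.rpow_le_rpow (by positivity) hζ.1 hs
  set D := |LPsymbol χ φ j η - LPsymbol χ φ j ξ| with hD
  have hD0 : 0 ≤ D := abs_nonneg _
  have hD1 : D ≤ 1 := by
    have h1 := LPsymbol_mem_Icc hχ01 hφ01 j η
    have h2 := LPsymbol_mem_Icc hχ01 hφ01 j ξ
    rw [hD, abs_le]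
    constructor <;> linarith [h1.1, h1.2, h2.1, h2.2]
  have hDL := hL j hj ξ η
  have hn := norm_nonneg (ξ - η)
  have hi : ∀ ζ, (0 : ℝ) ≤ (dyadicShell d j).indicator 1 ζ :=
    fun ζ => indicator_nonneg (by simp) ζ
  by_cases hη : η ∈ dyadicShell d j
  · obtain ⟨a1, a2⟩ := hshell η hη
    have b1 : ‖η‖ * D ≤ (5 * L + 1) * ‖ξ - η‖ := calc
      _ ≤ 5 * 2 ^ j * D := by gcongr
      _ ≤ _ := by nlinarith
    calc _ ≤ (2 ^ s * besselWeight s η) * ((5 * L + 1) * ‖ξ - η‖) := by gcongr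
      _ = (5 * L + 1) * (2 ^ s * 1) * (‖ξ - η‖ * (1 * besselWeight s η + 0)) := by ring
      _ ≤ _ := by
        rw [indicator_of_mem hη, Pi.one_apply]
        have := hi ξ
        gcongr
        positivity
  · by_cases hξ : ξ ∈ dyadicShell d j
    · obtain ⟨a1, a2⟩ := hshell ξ hξ
      have htri : ‖η‖ ≤ ‖ξ‖ + ‖ξ - η‖ := by
        simpa using norm_sub_le ξ (ξ - η)
      have b1 : ‖η‖ * D ≤ (5 * L + 1) * ‖ξ - η‖ := calc
        _ ≤ (5 * 2 ^ j + ‖ξ - η‖) * D := by gcongr; linarith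
        _ ≤ _ := by nlinarith
      calc _ ≤ (2 ^ s * (2 ^ s * (besselWeight s (ξ - η) + besselWeight s η))) *
            ((5 * L + 1) * ‖ξ - η‖) := by
            gcongr
            exact a1.trans (by gcongr; exact besselWeight_le hs ξ η)
        _ = _ := by
          rw [indicator_of_mem hξ, indicator_of_notMem hη, Pi.one_apply]
          ring
    · have e1 : LPsymbol χ φ j η = 0 :=
        not_not.1 (mt (mem_dyadicShell_of_LPsymbol_ne_zero hχ hφ hj) hη)
      have e2 : LPsymbol χ φ j ξ = 0 :=
        not_not.1 (mt (mem_dyadicShell_of_LPsymbol_ne_zero hχ hφ hj) hξ)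
      simp [hD, e1, e2, hη, hξ]

end Symbol

section Fourier

open SchwartzMap LineDeriv
open scoped SchwartzMap

theorem eLpNorm_fourier_two {V : Type*} [NormedAddCommGroup V] [InnerProductSpace ℝ V]
    [FiniteDimensional ℝ V] [MeasurableSpace V] [BorelSpace V] (f : 𝓢(V, ℂ)) :
    eLpNorm (𝓕 f : 𝓢(V, ℂ)) 2 volume = eLpNorm f 2 volume := by
  have h := norm_fourier_toL2_eq f
  rw [norm_toLp, norm_toLp] at h
  have h₁ : eLpNorm (𝓕 f : 𝓢(V, ℂ)) 2 volume < ∞ := (memLp (𝓕 f : 𝓢(V, ℂ)) 2 volume).2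
  have h₂ : eLpNorm f 2 volume < ∞ := (memLp f 2 volume).2
  exact (ENNReal.toReal_eq_toReal_iff' h₁.ne h₂.ne).1 h

theorem fourier_pairing_mul_apply {V : Type*} [NormedAddCommGroup V] [InnerProductSpace ℝ V]
    [FiniteDimensional ℝ V] [MeasurableSpace V] [BorelSpace V] (f g : 𝓢(V, ℂ)) (ξ : V) :
    (𝓕 (pairing (ContinuousLinearMap.mul ℂ ℂ) f g) : 𝓢(V, ℂ)) ξ =
      ∫ η, (𝓕 f : 𝓢(V, ℂ)) (ξ - η) * (𝓕 g : 𝓢(V, ℂ)) η := by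
  have h : 𝓕⁻ (SchwartzMap.convolution (ContinuousLinearMap.mul ℂ ℂ) (𝓕 f) (𝓕 g)) =
      pairing (ContinuousLinearMap.mul ℂ ℂ) f g := by
    ext x
    rw [fourierInv_apply_eq]
    simp only [compCLMOfContinuousLinearEquiv_apply, Function.comp]
    rw [fourier_convolution]
    have e : ∀ (k : 𝓢(V, ℂ)) (y : V), (𝓕 (𝓕 k : 𝓢(V, ℂ)) : 𝓢(V, ℂ)) (-y) = k y := fun k y => by
      have := congr_arg (fun k : 𝓢(V, ℂ) => k y) (fourierInv_apply_eq (𝓕 k : 𝓢(V, ℂ)))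
      simpa using this.symm
    simp [e]
  rw [← h, FourierTransform.fourier_fourierInv_eq, SchwartzMap.convolution_apply,
    MeasureTheory.convolution_eq_swap]
  simp

/-- Complexification of a real Schwartz function. -/
def complexify {d : ℕ} (f : 𝓢(Rd d, ℝ)) : 𝓢(Rd d, ℂ) := f.postcompCLM Complex.ofRealCLM

theorem coe_complexify {d : ℕ} (f : 𝓢(Rd d, ℝ)) : ⇑(complexify f) = cplx f := by
  ext x; simp [complexify, cplx]

theorem coe_fourier_complexify {d : ℕ} (f : 𝓢(Rd d, ℝ)) :
    ⇑(𝓕 (complexify f) : 𝓢(Rd d, ℂ)) = FT f := by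
  rw [fourier_coe, coe_complexify]; rfl

theorem continuous_FT {d : ℕ} (f : 𝓢(Rd d, ℝ)) : Continuous (FT f) := by
  rw [← coe_fourier_complexify]; exact (𝓕 (complexify f) : 𝓢(Rd d, ℂ)).continuous

theorem fourier_lineDeriv_single_apply {d : ℕ} (i : Fin d) (f : 𝓢(Rd d, ℂ)) (ξ : Rd d) :
    (𝓕 (∂_{EuclideanSpace.single i (1 : ℝ)} f) : 𝓢(Rd d, ℂ)) ξ =
      2 * π * Complex.I * ξ i * (𝓕 f : 𝓢(Rd d, ℂ)) ξ := by
  have : (inner ℝ · (EuclideanSpace.single i (1 : ℝ)) : Rd d → ℝ).HasTemperateGrowth := by fun_prop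
  rw [fourier_lineDerivOp_eq]
  rw [smul_apply, smulLeftCLM_apply_apply this]
  simp [mul_assoc, EuclideanSpace.inner_single_right]

theorem coe_lineDeriv_single {d : ℕ} (i : Fin d) (f : 𝓢(Rd d, ℂ)) :
    ⇑(∂_{EuclideanSpace.single i (1 : ℝ)} f : 𝓢(Rd d, ℂ)) = pdC i f := by
  ext x; rw [lineDerivOp_apply_eq_fderiv]; rfl

theorem complexify_lineDeriv_single {d : ℕ} (i : Fin d) (f : 𝓢(Rd d, ℝ)) :
    ⇑(∂_{EuclideanSpace.single i (1 : ℝ)} (complexify f) : 𝓢(Rd d, ℂ)) = cplx (pd i f) := by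
  ext x
  rw [lineDerivOp_apply_eq_fderiv, coe_complexify]
  have h := (Complex.ofRealCLM.hasFDerivAt.comp x (f.hasFDerivAt x)).fderiv
  change fderiv ℝ (Complex.ofRealCLM ∘ f) x _ = _
  rw [h]
  simp [cplx, pd]

theorem FT_pd {d : ℕ} (i : Fin d) (f : 𝓢(Rd d, ℝ)) (ξ : Rd d) :
    FT (pd i f) ξ = 2 * π * Complex.I * ξ i * FT f ξ := by
  rw [← coe_fourier_complexify, ← fourier_lineDeriv_single_apply, fourier_coe,
    complexify_lineDeriv_single]
  rfl

theorem sum_HSq_pd {d : ℕ} (r : ℝ) (f : 𝓢(Rd d, ℝ)) :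
    ∑ k, HSq r (pd k f) = ∫⁻ ξ : Rd d,
      (ENNReal.ofReal (besselWeight r ξ) * ENNReal.ofReal (2 * π * ‖ξ‖ * ‖FT f ξ‖)) ^ 2 := by
  have hFT : Measurable (FT f) := (continuous_FT f).measurable
  simp only [HSq, FT_pd]
  rw [← lintegral_finsetSum _ fun k _ => by fun_prop]
  refine lintegral_congr fun ξ => ?_
  rw [← ENNReal.ofReal_sum_of_nonneg fun k _ => by positivity,
    ← ENNReal.ofReal_mul (besselWeight_pos _ _).le, ← ENNReal.ofReal_pow
      (mul_nonneg (besselWeight_pos _ _).le (by positivity)), mul_pow, besselWeight_sq]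
  congr 1
  rw [← Finset.mul_sum]
  congr 1
  simp only [norm_mul, mul_pow, EuclideanSpace.norm_sq_eq, Finset.mul_sum, Finset.sum_mul]
  simp [abs_of_pos Real.pi_pos]

theorem HSq_lt_top {d : ℕ} (r : ℝ) (f : 𝓢(Rd d, ℝ)) : HSq r f < ∞ := by
  have hg : (fun ξ : Rd d => (1 + ‖ξ‖ ^ 2) ^ (r / 2)).HasTemperateGrowth := by fun_prop
  have h := (smulLeftCLM ℂ (fun ξ : Rd d => (1 + ‖ξ‖ ^ 2) ^ (r / 2))
    (𝓕 (complexify f))).eLpNorm_lt_top 2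
  rw [eLpNorm_lt_top_iff_lintegral_rpow_enorm_lt_top (by norm_num) (by norm_num)] at h
  refine lt_of_eq_of_lt (lintegral_congr fun ξ => ?_) h
  rw [smulLeftCLM_apply_apply hg, coe_fourier_complexify, ← besselWeight_sq, ← mul_pow,
    enorm_smul, ← ofReal_norm, ← ofReal_norm,
    ← ENNReal.ofReal_mul (norm_nonneg _), ENNReal.toReal_ofNat, ENNReal.rpow_two,
    ← ENNReal.ofReal_pow (by positivity)]
  rw [Real.norm_of_nonneg (by positivity)]
  rfl

/-- The Littlewood–Paley block as an operator on Schwartz functions. -/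
def LPoperator {d : ℕ} (χ φ : Rd d → ℝ) (j : ℤ) (f : 𝓢(Rd d, ℂ)) : 𝓢(Rd d, ℂ) :=
  𝓕⁻ (smulLeftCLM ℂ (fun ξ => (LPsymbol χ φ j ξ : ℂ)) (𝓕 f))

variable {d : ℕ} {χ φ : Rd d → ℝ}

theorem hasTemperateGrowth_LPsymbol
    (hχsm : ContDiff ℝ (⊤ : ℕ∞) χ) (hφsm : ContDiff ℝ (⊤ : ℕ∞) φ)
    (hχ : Function.support χ ⊆ {ξ : Rd d | ‖ξ‖ ≤ 4/3})
    (hφ : Function.support φ ⊆ {ξ : Rd d | 3/4 ≤ ‖ξ‖ ∧ ‖ξ‖ ≤ 8/3})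
    {j : ℤ} (hj : -1 ≤ j) :
    (fun ξ => (LPsymbol χ φ j ξ : ℂ)).HasTemperateGrowth :=
  ((hasCompactSupport_LPsymbol hχ hφ hj).comp_left Complex.ofReal_zero).hasTemperateGrowth
    (Complex.ofRealCLM.contDiff.comp (LPsymbol_contDiff hχsm hφsm j))

theorem coe_LPoperator {j : ℤ} (hj : -1 ≤ j)
    (hm : (fun ξ => (LPsymbol χ φ j ξ : ℂ)).HasTemperateGrowth) (f : 𝓢(Rd d, ℂ)) :
    ⇑(LPoperator χ φ j f) = LPblock χ φ j f := by
  rw [LPoperator, fourierInv_coe, smulLeftCLM_apply hm, fourier_coe]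
  unfold LPblock LPsymbol
  split_ifs
  · rfl
  · rfl
  · omega

theorem fourier_LPoperator_apply {j : ℤ}
    (hm : (fun ξ => (LPsymbol χ φ j ξ : ℂ)).HasTemperateGrowth) (f : 𝓢(Rd d, ℂ)) (ξ : Rd d) :
    (𝓕 (LPoperator χ φ j f) : 𝓢(Rd d, ℂ)) ξ = LPsymbol χ φ j ξ * (𝓕 f : 𝓢(Rd d, ℂ)) ξ := by
  rw [LPoperator, FourierTransform.fourier_fourierInv_eq, smulLeftCLM_apply_apply hm, smul_eq_mul]

/-- The commutator of the transport operator `u · ∇` with a Littlewood–Paley block. -/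
def LPcommutator (χ φ : Rd d → ℝ) (j : ℤ) (u : Fin d → 𝓢(Rd d, ℝ)) (f : 𝓢(Rd d, ℝ)) :
    𝓢(Rd d, ℂ) :=
  (∑ i, pairing (ContinuousLinearMap.mul ℂ ℂ) (complexify (u i))
    (∂_{EuclideanSpace.single i (1 : ℝ)} (LPoperator χ φ j (complexify f)))) -
  LPoperator χ φ j (∑ i, pairing (ContinuousLinearMap.mul ℂ ℂ) (complexify (u i))
    (∂_{EuclideanSpace.single i (1 : ℝ)} (complexify f)))

theorem coe_LPcommutator {j : ℤ} (hj : -1 ≤ j)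
    (hm : (fun ξ => (LPsymbol χ φ j ξ : ℂ)).HasTemperateGrowth)
    (u : Fin d → 𝓢(Rd d, ℝ)) (f : 𝓢(Rd d, ℝ)) (x : Rd d) :
    LPcommutator χ φ j u f x = (∑ i, (u i x : ℂ) * pdC i (LPblock χ φ j (cplx ⇑f)) x) -
      LPblock χ φ j (cplx fun y => ∑ i, u i y * pd i (⇑f) y) x := by
  rw [LPcommutator, sub_apply, coe_LPoperator hj hm, sum_apply]
  congr 1
  · simp only [pairing_apply_apply, coe_lineDeriv_single, coe_LPoperator hj hm, coe_complexify]
    rfl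
  · congr 1
    ext y
    simp only [sum_apply, pairing_apply_apply, complexify_lineDeriv_single, coe_complexify]
    simp [cplx]

theorem fourier_LPcommutator_apply {j : ℤ}
    (hm : (fun ξ => (LPsymbol χ φ j ξ : ℂ)).HasTemperateGrowth)
    (u : Fin d → 𝓢(Rd d, ℝ)) (f : 𝓢(Rd d, ℝ)) (ξ : Rd d) :
    (𝓕 (LPcommutator χ φ j u f) : 𝓢(Rd d, ℂ)) ξ =
      ∑ i, ∫ η, FT (u i) (ξ - η) * (2 * π * Complex.I * η i) *
        (LPsymbol χ φ j η - LPsymbol χ φ j ξ) * FT f η := by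
  have hint : ∀ g h : 𝓢(Rd d, ℂ), Integrable fun η =>
      (𝓕 g : 𝓢(Rd d, ℂ)) (ξ - η) * (𝓕 h : 𝓢(Rd d, ℂ)) η := fun g h =>
    (𝓕 h : 𝓢(Rd d, ℂ)).integrable.bdd_mul (c := SchwartzMap.seminorm ℝ 0 0 (𝓕 g : 𝓢(Rd d, ℂ)))
      (by fun_prop) (Filter.Eventually.of_forall fun η => norm_le_seminorm ℝ _ _)
  rw [LPcommutator, sub_eq_add_neg, FourierTransform.fourier_add,
    FourierTransform.fourier_neg, ← sub_eq_add_neg, sub_apply, fourier_LPoperator_apply hm,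
    FourierTransform.fourier_sum, FourierTransform.fourier_sum, sum_apply, sum_apply,
    Finset.mul_sum, ← Finset.sum_sub_distrib]
  refine Finset.sum_congr rfl fun i _ => ?_
  rw [fourier_pairing_mul_apply, fourier_pairing_mul_apply, ← integral_const_mul,
    ← integral_sub (hint _ _) ((hint _ _).const_mul _)]
  refine integral_congr_ae (Filter.Eventually.of_forall fun η => ?_)
  simp only [fourier_lineDeriv_single_apply, fourier_LPoperator_apply hm, coe_fourier_complexify]
  ring

end Fourier

theorem coe_indicator_one {α : Type*} (S : Set α) (x : α) :
    (S.indicator 1 x : ℝ≥0∞) = ENNReal.ofReal (S.indicator 1 x) := by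
  by_cases h : x ∈ S <;> simp [h]

section Commutator

open SchwartzMap LineDeriv
open scoped SchwartzMap

variable {d : ℕ} {χ φ : Rd d → ℝ}

/-- A majorant of the Fourier transform of the gradient of `u`. -/
def gradMajorant (u : Fin d → 𝓢(Rd d, ℝ)) (ξ : Rd d) : ℝ≥0∞ :=
  ∑ i, ENNReal.ofReal (2 * π * ‖ξ‖ * ‖FT (u i) ξ‖)

theorem measurable_gradMajorant (u : Fin d → 𝓢(Rd d, ℝ)) : Measurable (gradMajorant u) := by
  have := fun i => (continuous_FT (u i)).measurable
  unfold gradMajorant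
  fun_prop

theorem lintegral_sq_besselWeight_mul_gradMajorant_le (s : ℝ) (u : Fin d → 𝓢(Rd d, ℝ)) :
    ∫⁻ ξ, (ENNReal.ofReal (besselWeight s ξ) * gradMajorant u ξ) ^ 2 ≤
      d * ∑ i, ∑ k, HSq s (pd k (u i)) := by
  have hm := fun i => (continuous_FT (u i)).measurable
  simp only [sum_HSq_pd]
  rw [← lintegral_finsetSum _ fun i _ => by have := hm i; fun_prop,
    ← lintegral_const_mul _ (by fun_prop)]
  refine lintegral_mono fun ξ => ?_
  simp only [gradMajorant, Finset.mul_sum]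
  refine (sum_sq_le_card_mul _).trans_eq ?_
  rw [Fintype.card_fin, Finset.mul_sum]

theorem enorm_fourier_LPcommutator_le {s C : ℝ} {j : ℤ} (hC : 0 ≤ C)
    (hm : (fun ξ => (LPsymbol χ φ j ξ : ℂ)).HasTemperateGrowth)
    (hker : ∀ ξ η : Rd d,
      (2 : ℝ) ^ ((j : ℝ) * s) * (‖η‖ * |LPsymbol χ φ j η - LPsymbol χ φ j ξ|) ≤
        C * (‖ξ - η‖ * ((dyadicShell d j).indicator 1 η * besselWeight s η +
          (dyadicShell d j).indicator 1 ξ * (besselWeight s (ξ - η) + besselWeight s η))))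
    (u : Fin d → 𝓢(Rd d, ℝ)) (f : 𝓢(Rd d, ℝ)) (ξ : Rd d) :
    ENNReal.ofReal ((2 : ℝ) ^ ((j : ℝ) * s)) * ‖(𝓕 (LPcommutator χ φ j u f) : 𝓢(Rd d, ℂ)) ξ‖ₑ ≤
      ENNReal.ofReal C * ∫⁻ η, gradMajorant u (ξ - η) *
        ((dyadicShell d j).indicator 1 η * ENNReal.ofReal (besselWeight s η) +
          (dyadicShell d j).indicator 1 ξ * (ENNReal.ofReal (besselWeight s (ξ - η)) +
            ENNReal.ofReal (besselWeight s η))) * ENNReal.ofReal ‖FT f η‖ := by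
  have hp : (0 : ℝ) ≤ (2 : ℝ) ^ ((j : ℝ) * s) := by positivity
  have hI : ∀ x : Rd d, 0 ≤ (dyadicShell d j).indicator (1 : Rd d → ℝ) x :=
    fun x => indicator_nonneg (fun _ _ => zero_le_one) x
  have hw : ∀ x : Rd d, 0 ≤ besselWeight s x := fun x => (besselWeight_pos s x).le
  have hmc : Continuous fun η => (LPsymbol χ φ j η : ℂ) := hm.1.continuous
  have hFT := fun i => continuous_FT (u i)
  have hFf := continuous_FT f
  rw [fourier_LPcommutator_apply hm]
  refine (mul_le_mul_right ((enorm_sum_le _ _).trans (Finset.sum_le_sum fun i _ =>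
    enorm_integral_le_lintegral_enorm _)) _).trans ?_
  rw [← lintegral_finsetSum _ fun i _ => by have := hFT i; fun_prop,
    ← lintegral_const_mul' _ _ ENNReal.ofReal_ne_top,
    ← lintegral_const_mul' _ _ ENNReal.ofReal_ne_top]
  refine lintegral_mono fun η => ?_
  simp only [gradMajorant, Finset.mul_sum, Finset.sum_mul]
  refine Finset.sum_le_sum fun i _ => ?_
  have h₀ : 0 ≤ (dyadicShell d j).indicator 1 η * besselWeight s η +
      (dyadicShell d j).indicator 1 ξ * (besselWeight s (ξ - η) + besselWeight s η) :=
    add_nonneg (mul_nonneg (hI _) (hw _)) (mul_nonneg (hI _) (add_nonneg (hw _) (hw _)))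
  rw [coe_indicator_one, coe_indicator_one, ← ofReal_norm,
    ← ENNReal.ofReal_add (hw _) (hw _), ← ENNReal.ofReal_mul (hI _), ← ENNReal.ofReal_mul (hI _),
    ← ENNReal.ofReal_add (mul_nonneg (hI _) (hw _))
      (mul_nonneg (hI _) (add_nonneg (hw _) (hw _))),
    ← ENNReal.ofReal_mul hp, ← ENNReal.ofReal_mul (by positivity),
    ← ENNReal.ofReal_mul (by positivity), ← ENNReal.ofReal_mul hC]
  refine ENNReal.ofReal_le_ofReal ?_
  have hη : |η i| ≤ ‖η‖ := PiLp.norm_apply_le η i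
  have hn : ‖(LPsymbol χ φ j η : ℂ) - LPsymbol χ φ j ξ‖ =
      |LPsymbol χ φ j η - LPsymbol χ φ j ξ| := by
    rw [← Complex.ofReal_sub, Complex.norm_real, Real.norm_eq_abs]
  simp only [norm_mul, hn, Complex.norm_real, Complex.norm_I, Complex.norm_ofNat, mul_one,
    Real.norm_eq_abs, abs_of_pos Real.pi_pos]
  calc _ = 2 * π * ‖FT (u i) (ξ - η)‖ * ‖FT f η‖ * ((2 : ℝ) ^ ((j : ℝ) * s) *
          (|η i| * |LPsymbol χ φ j η - LPsymbol χ φ j ξ|)) := by ring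
    _ ≤ 2 * π * ‖FT (u i) (ξ - η)‖ * ‖FT f η‖ * ((2 : ℝ) ^ ((j : ℝ) * s) *
          (‖η‖ * |LPsymbol χ φ j η - LPsymbol χ φ j ξ|)) := by gcongr
    _ ≤ _ := mul_le_mul_of_nonneg_left (hker ξ η) (by positivity)
    _ = _ := by ring

theorem eLpNorm_two_sq {α E : Type*} [MeasurableSpace α] [NormedAddCommGroup E] (f : α → E)
    (μ : Measure α) : eLpNorm f 2 μ ^ 2 = ∫⁻ x, ‖f x‖ₑ ^ 2 ∂μ := by
  rw [eLpNorm_eq_lintegral_rpow_enorm_toReal (by norm_num) (by norm_num), ENNReal.toReal_ofNat,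
    ← ENNReal.rpow_natCast, ← ENNReal.rpow_mul]
  norm_num

theorem tsum_sq_eLpNorm_LPcommutator_le {s C : ℝ} (hC : 0 ≤ C)
    (hm : ∀ j : ℤ, -1 ≤ j → (fun ξ => (LPsymbol χ φ j ξ : ℂ)).HasTemperateGrowth)
    (hker : ∀ j : ℤ, -1 ≤ j → ∀ ξ η : Rd d,
      (2 : ℝ) ^ ((j : ℝ) * s) * (‖η‖ * |LPsymbol χ φ j η - LPsymbol χ φ j ξ|) ≤
        C * (‖ξ - η‖ * ((dyadicShell d j).indicator 1 η * besselWeight s η +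
          (dyadicShell d j).indicator 1 ξ * (besselWeight s (ξ - η) + besselWeight s η))))
    (u : Fin d → 𝓢(Rd d, ℝ)) (f : 𝓢(Rd d, ℝ)) :
    ∑' j : {j : ℤ // -1 ≤ j}, (ENNReal.ofReal ((2 : ℝ) ^ (((j : ℤ) : ℝ) * s)) *
        eLpNorm (LPcommutator χ φ j u f) 2 volume) ^ 2 ≤
      ENNReal.ofReal C ^ 2 * (36 * (∫⁻ ξ : Rd d, ENNReal.ofReal (besselWeight (-s) ξ) ^ 2) *
        (d * ∑ i, ∑ k, HSq s (pd k (u i))) * HSq s f) := by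
  have hF : Measurable fun η => ENNReal.ofReal ‖FT f η‖ := by
    have := (continuous_FT f).measurable
    fun_prop
  have hHf : ∫⁻ ξ, (ENNReal.ofReal (besselWeight s ξ) * ENNReal.ofReal ‖FT f ξ‖) ^ 2 =
      HSq s f := by
    refine lintegral_congr fun ξ => ?_
    rw [← ENNReal.ofReal_mul (besselWeight_pos _ _).le, ← ENNReal.ofReal_pow
      (mul_nonneg (besselWeight_pos _ _).le (norm_nonneg _)), mul_pow, besselWeight_sq]
  have hT := tsum_lintegral_sq_shell_convolution_le s (measurable_gradMajorant u) hF
  refine le_trans (ENNReal.tsum_le_tsum fun j => ?_) <|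
    (ENNReal.tsum_comp_le_tsum_of_injective Subtype.val_injective _).trans <|
    (ENNReal.tsum_mul_left (a := ENNReal.ofReal C ^ 2)).trans_le <|
    mul_le_mul_right (hT.trans ?_) _
  · rw [← eLpNorm_fourier_two, mul_pow, eLpNorm_two_sq,
      ← lintegral_const_mul' _ _ (by finiteness), ← lintegral_const_mul' _ _ (by finiteness)]
    refine lintegral_mono fun ξ => ?_
    rw [← mul_pow, ← mul_pow]
    exact pow_le_pow_left' (enorm_fourier_LPcommutator_le hC (hm j j.2) (hker j j.2) u f ξ) 2
  · rw [hHf]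
    gcongr
    exact lintegral_sq_besselWeight_mul_gradMajorant_le s u

end Commutator

theorem rpow_half_sq (x : ℝ≥0∞) : (x ^ (1 / 2 : ℝ)) ^ 2 = x := by
  rw [← ENNReal.rpow_natCast, ← ENNReal.rpow_mul]
  norm_num

theorem HSq_pd_lt_top {d : ℕ} (r : ℝ) (k : Fin d) (f : SchwartzMap (Rd d) ℝ) :
    HSq r (pd k f) < ∞ := by
  have h : ⇑(LineDeriv.lineDerivOp (EuclideanSpace.single k (1 : ℝ)) f : SchwartzMap (Rd d) ℝ) =
      pd k f := by
    ext x; rw [SchwartzMap.lineDerivOp_apply_eq_fderiv]; rfl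
  exact h ▸ HSq_lt_top r _

/-- commutator estimate for the transport operator and
Littlewood–Paley blocks (Lemma 2.8). -/
theorem commutator_estimate (d : ℕ) (hd : 1 ≤ d) (σ : ℝ) (hσ : (d : ℝ) / 2 - 1 < σ)
    (χ φ : Rd d → ℝ) (hχsm : ContDiff ℝ (⊤ : ℕ∞) χ) (hφsm : ContDiff ℝ (⊤ : ℕ∞) φ)
    (hχ01 : ∀ ξ, χ ξ ∈ Icc (0:ℝ) 1) (hφ01 : ∀ ξ, φ ξ ∈ Icc (0:ℝ) 1)
    (hχsupp : Function.support χ ⊆ {ξ : Rd d | ‖ξ‖ ≤ 4/3})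
    (hφsupp : Function.support φ ⊆ {ξ : Rd d | 3/4 ≤ ‖ξ‖ ∧ ‖ξ‖ ≤ 8/3})
    (hpart : ∀ ξ : Rd d, χ ξ + ∑' j : ℕ, φ ((2 : ℝ) ^ (-(j : ℤ)) • ξ) = 1) :
    ∃ C > (0:ℝ), ∀ u : Fin d → SchwartzMap (Rd d) ℝ, ∀ f : SchwartzMap (Rd d) ℝ,
      ∃ c : ℤ → ℝ, (∀ j, 0 ≤ c j) ∧
        HasSum (fun j : {j : ℤ // -1 ≤ j} => (c j) ^ 2) 1 ∧
        ∀ j : ℤ, -1 ≤ j →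
          eLpNorm
              (fun x : Rd d =>
                (∑ i, (u i x : ℂ) * pdC i (LPblock χ φ j (cplx ⇑f)) x) -
                  LPblock χ φ j (cplx fun y => ∑ i, u i y * pd i (⇑f) y) x)
              2 volume ≤
            ENNReal.ofReal (C * c j * 2 ^ (-(j : ℝ) * (σ + 1))) *
              (∑ i, ∑ k, HSq (σ + 1) (pd k (⇑(u i)))) ^ (1/2 : ℝ) *
              Hn (σ + 1) (⇑f) := by
  have hs : (d : ℝ) / 2 < σ + 1 := by linarith
  have hs0 : 0 ≤ σ + 1 := le_trans (by positivity) hs.le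
  obtain ⟨C, hC, hker⟩ := exists_commutator_kernel_le hs0 hχsm hφsm hχ01 hφ01 hχsupp hφsupp
  have hm : ∀ j : ℤ, -1 ≤ j → (fun ξ => (LPsymbol χ φ j ξ : ℂ)).HasTemperateGrowth :=
    fun j hj => hasTemperateGrowth_LPsymbol hχsm hφsm hχsupp hφsupp hj
  set A := ∫⁻ ξ : Rd d, ENNReal.ofReal (besselWeight (-(σ + 1)) ξ) ^ 2
  have hA : 36 * A * d ≠ ∞ := by
    have : A ≠ ∞ := (lintegral_besselWeight_neg_lt_top hs).ne
    finiteness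
  set T := (36 * A * d).toReal
  have hT0 : 0 ≤ T := ENNReal.toReal_nonneg
  have hT : 36 * A * d ≤ ENNReal.ofReal (T + 1) := by
    rw [← ENNReal.ofReal_toReal hA]
    exact ENNReal.ofReal_le_ofReal (by linarith)
  refine ⟨C * √(T + 1), by positivity, fun u f => ?_⟩
  set S := ∑ i, ∑ k, HSq (σ + 1) (pd k (⇑(u i)))
  set a : {j : ℤ // -1 ≤ j} → ℝ≥0∞ := fun j =>
    ENNReal.ofReal ((2 : ℝ) ^ (((j : ℤ) : ℝ) * (σ + 1))) *
      eLpNorm (LPcommutator χ φ j u f) 2 volume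
  set M := S ^ (1 / 2 : ℝ) * Hn (σ + 1) (⇑f)
  have hS : S ≠ ∞ := ENNReal.sum_ne_top.2 fun i _ => ENNReal.sum_ne_top.2 fun k _ =>
    (HSq_pd_lt_top _ k (u i)).ne
  have hM : M ≠ ∞ := ENNReal.mul_ne_top (ENNReal.rpow_ne_top_of_nonneg (by norm_num) hS)
    (ENNReal.rpow_ne_top_of_nonneg (by norm_num) (HSq_lt_top _ f).ne)
  have ha : ∑' j, a j ^ 2 ≤ (ENNReal.ofReal (C * √(T + 1)) * M) ^ 2 := by
    refine (tsum_sq_eLpNorm_LPcommutator_le hC.le hm hker u f).trans ?_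
    rw [ENNReal.ofReal_mul hC.le, mul_pow, mul_pow, mul_pow (S ^ _), Hn, rpow_half_sq,
      rpow_half_sq, ← ENNReal.ofReal_pow (Real.sqrt_nonneg _), Real.sq_sqrt (by positivity)]
    calc _ = ENNReal.ofReal C ^ 2 * (36 * A * d) * (S * HSq (σ + 1) f) := by ring
      _ ≤ _ := by gcongr
  obtain ⟨c, hc0, hc1, hc⟩ := exists_hasSum_sq_one ⟨-1, le_rfl⟩ a (by finiteness) ha
  refine ⟨fun j => if h : -1 ≤ j then c ⟨j, h⟩ else 0, fun j => ?_, ?_, fun j hj => ?_⟩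
  · dsimp only
    split_ifs
    exacts [hc0 _, le_rfl]
  · convert! hc1 using 3 with j
    exact dif_pos j.2
  · simp only [← coe_LPcommutator hj (hm j hj) u f, dif_pos hj]
    have h := mul_le_mul_right (hc ⟨j, hj⟩)
      (ENNReal.ofReal ((2 : ℝ) ^ (-(j : ℝ) * (σ + 1))))
    have hp : (2 : ℝ) ^ (-(j : ℝ) * (σ + 1)) * 2 ^ ((j : ℝ) * (σ + 1)) = 1 := by
      rw [← Real.rpow_add two_pos]; simp
    have hp0 : (0 : ℝ) ≤ 2 ^ (-(j : ℝ) * (σ + 1)) := by positivity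
    rw [← mul_assoc, ← ENNReal.ofReal_mul hp0, hp, ENNReal.ofReal_one, one_mul] at h
    refine h.trans_eq ?_
    rw [ENNReal.ofReal_mul' hp0, ENNReal.ofReal_mul' (hc0 _)]
    simp only [M]
    ring
end
end
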